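/- For every matroid M with finite ground set E and rank r+1, the f-vector of the broken circuit complex of M is nonnegative and log-concave: f_k ≥ 0 for all 0 ≤ k ≤ r+1, and f_{k-1}·f_{k+1} ≤ f_k² for all 0 < k < r+1. -/

import Mathlib

open Polynomial

/-- The rank of a set `X` in a matroid `M`: the supremum of the cardinalities of the
independent subsets of `X`. -/
noncomputable def matroidRank {α : Type*} (M : Matroid α) (X : Set α) : ℕ :=
  sSup {m | ∃ I ⊆ X, M.Indep I ∧ I.ncard = m}

/-- The characteristic polynomial of a matroid `M` of rank `r + 1` whose ground set is a
finite type `α` :  `χ_M(q) = Σ_{S ⊆ E} (−1)^{|S|} q^{(r+1) − rk(S)}`. -/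
noncomputable def matroidCharPoly {α : Type*} [Fintype α] (M : Matroid α) (r : ℕ) :
    Polynomial ℤ :=
  ∑ S : Finset α, (-1 : Polynomial ℤ) ^ S.card * X ^ (r + 1 - matroidRank M ↑S)

section LinearAlgebra

open Matrix

variable {ι : Type*} [Fintype ι]

theorem Matrix.IsSymm.exists_mulVec_eq {L : Matrix ι ι ℝ} (hL : L.IsSymm) (b : ι → ℝ)
    (hb : ∀ k : ι → ℝ, L *ᵥ k = 0 → k ⬝ᵥ b = 0) : ∃ u : ι → ℝ, L *ᵥ u = b := by
  classical
  have hsymm : (Matrix.toEuclideanLin L).IsSymmetric := by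
    rw [Matrix.isSymmetric_toEuclideanLin_iff, Matrix.IsHermitian,
      Matrix.conjTranspose_eq_transpose_of_trivial]
    exact hL
  have hmem : WithLp.toLp 2 b ∈ LinearMap.range (Matrix.toEuclideanLin L) := by
    rw [← Submodule.orthogonal_orthogonal (LinearMap.range (Matrix.toEuclideanLin L)),
      hsymm.orthogonal_range, Submodule.mem_orthogonal]
    intro k hk
    have h0 : L *ᵥ (k.ofLp) = 0 := by
      have := congrArg WithLp.ofLp (LinearMap.mem_ker.1 hk)
      simpa using this
    have h1 := hb _ h0
    simpa [PiLp.inner_apply, dotProduct, mul_comm] using h1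
  obtain ⟨u, hu⟩ := hmem
  refine ⟨u.ofLp, ?_⟩
  have := congrArg WithLp.ofLp hu
  simpa using this

theorem Matrix.IsSymm.dotProduct_mulVec_comm {L : Matrix ι ι ℝ} (hL : L.IsSymm) (x y : ι → ℝ) :
    x ⬝ᵥ L *ᵥ y = y ⬝ᵥ L *ᵥ x := by
  rw [dotProduct_mulVec, ← mulVec_transpose, hL.eq, dotProduct_comm]

theorem Matrix.IsSymm.sq_dotProduct_mulVec_le {L : Matrix ι ι ℝ} (hL : L.IsSymm)
    (hpos : ∀ z : ι → ℝ, 0 ≤ z ⬝ᵥ L *ᵥ z) (x y : ι → ℝ) :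
    (x ⬝ᵥ L *ᵥ y) ^ 2 ≤ (x ⬝ᵥ L *ᵥ x) * (y ⬝ᵥ L *ᵥ y) := by
  have key : ∀ s : ℝ, 0 ≤ (x ⬝ᵥ L *ᵥ x) * (s * s) + (2 * (x ⬝ᵥ L *ᵥ y)) * s + y ⬝ᵥ L *ᵥ y := by
    intro s
    have h := hpos (s • x + y)
    simp only [mulVec_add, mulVec_smul, dotProduct_add, add_dotProduct, smul_dotProduct,
      dotProduct_smul, smul_eq_mul, hL.dotProduct_mulVec_comm y x] at h
    linarith
  have := discrim_le_zero key
  simp only [discrim] at this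
  nlinarith

/-- If a symmetric matrix with nonnegative off-diagonal entries is irreducible, has a positive
vector with positive image, and satisfies a Bochner type inequality, then it satisfies the
reversed Cauchy-Schwarz inequality at that vector. -/
theorem Matrix.IsSymm.reversed_cauchy_schwarz_of_bochner {M : Matrix ι ι ℝ} (hM : M.IsSymm)
    (hoff : ∀ i j, i ≠ j → 0 ≤ M i j)
    (hconn : ∀ c : ι → ℝ, (∀ i j, i ≠ j → 0 < M i j → c i = c j) → ∀ i j, c i = c j)
    (v : ι → ℝ) (hv : ∀ i, 0 < v i) (hMv : ∀ i, 0 < (M *ᵥ v) i)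
    (hboch : ∀ z : ι → ℝ, z ⬝ᵥ M *ᵥ z ≤ ∑ i, v i * (M *ᵥ z) i ^ 2 / (M *ᵥ v) i)
    (z : ι → ℝ) :
    (v ⬝ᵥ M *ᵥ v) * (z ⬝ᵥ M *ᵥ z) ≤ (v ⬝ᵥ M *ᵥ z) ^ 2 := by
  classical
  rcases isEmpty_or_nonempty ι with hι | hι
  · simp [dotProduct]
  set w : ι → ℝ := fun i => (M *ᵥ v) i / v i with hw
  have hwpos : ∀ i, 0 < w i := fun i => div_pos (hMv i) (hv i)
  have hwv : ∀ i, w i * v i = (M *ᵥ v) i := fun i => div_mul_cancel₀ _ (hv i).ne'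
  set L : Matrix ι ι ℝ := Matrix.diagonal w - M with hLdef
  have hL : L.IsSymm := by
    rw [hLdef]
    exact (Matrix.isSymm_diagonal w).sub hM
  have hLz : ∀ (z : ι → ℝ) i, (L *ᵥ z) i = w i * z i - (M *ᵥ z) i := by
    intro z i
    simp [hLdef, sub_mulVec, mulVec_diagonal]
  have hquad : ∀ z : ι → ℝ, z ⬝ᵥ L *ᵥ z =
      (∑ i, ∑ j, M i j * v i * v j * (z i / v i - z j / v j) ^ 2) / 2 := by
    intro z
    have e1 : ∀ i j, M i j * v i * v j * (z i / v i - z j / v j) ^ 2 =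
        (z i ^ 2 / v i) * (M i j * v j) + (z j ^ 2 / v j) * (M j i * v i)
          - 2 * (z i * (M i j * z j)) := by
      intro i j
      have hi := (hv i).ne'
      have hj := (hv j).ne'
      rw [hM.apply i j]
      field_simp
      ring
    simp_rw [e1, Finset.sum_sub_distrib, Finset.sum_add_distrib]
    rw [Finset.sum_comm (f := fun i j => (z j ^ 2 / v j) * (M j i * v i))]
    simp_rw [← Finset.mul_sum]
    have e2 : ∀ z : ι → ℝ, ∀ i, ∑ j, M i j * z j = (M *ᵥ z) i := fun z i => rfl
    simp_rw [e2]
    simp only [dotProduct, hLz, mul_sub, Finset.sum_sub_distrib]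
    have e3 : ∀ i, z i ^ 2 / v i * (M *ᵥ v) i = z i * (w i * z i) := by
      intro i
      simp only [hw]
      have hi := (hv i).ne'
      field_simp
    simp_rw [e3]
    ring
  have hterm : ∀ (z : ι → ℝ) i j, 0 ≤ M i j * v i * v j * (z i / v i - z j / v j) ^ 2 := by
    intro z i j
    by_cases hij : i = j
    · subst hij; simp
    · exact mul_nonneg (mul_nonneg (mul_nonneg (hoff i j hij) (hv i).le) (hv j).le) (sq_nonneg _)
  have hLpos : ∀ z : ι → ℝ, 0 ≤ z ⬝ᵥ L *ᵥ z := by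
    intro z
    rw [hquad]
    exact div_nonneg (Finset.sum_nonneg fun i _ => Finset.sum_nonneg fun j _ => hterm z i j)
      zero_le_two
  have hker : ∀ k : ι → ℝ, L *ᵥ k = 0 → ∃ c : ℝ, k = c • v := by
    intro k hk
    have h0 := hquad k
    rw [hk, dotProduct_zero] at h0
    have h1 : ∑ i, ∑ j, M i j * v i * v j * (k i / v i - k j / v j) ^ 2 = 0 := by linarith
    rw [Finset.sum_eq_zero_iff_of_nonneg
      (fun i _ => Finset.sum_nonneg fun j _ => hterm k i j)] at h1
    have hc := hconn (fun i => k i / v i) (by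
      intro i j hij hpos
      have h2 := h1 i (Finset.mem_univ _)
      rw [Finset.sum_eq_zero_iff_of_nonneg (fun j _ => hterm k i j)] at h2
      have h3 := h2 j (Finset.mem_univ _)
      have h4 : 0 < M i j * v i * v j := mul_pos (mul_pos hpos (hv i)) (hv j)
      have h5 : (k i / v i - k j / v j) ^ 2 = 0 := by
        rcases mul_eq_zero.1 h3 with h | h
        · exact absurd h h4.ne'
        · exact h
      exact sub_eq_zero.1 (pow_eq_zero_iff two_ne_zero |>.1 h5))
    obtain ⟨i₀⟩ := hι
    refine ⟨k i₀ / v i₀, funext fun i => ?_⟩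
    simp only [Pi.smul_apply, smul_eq_mul]
    rw [hc i₀ i, div_mul_cancel₀ _ (hv i).ne']
  have hMz : ∀ z : ι → ℝ, z ⬝ᵥ M *ᵥ z = ∑ i, w i * z i ^ 2 - z ⬝ᵥ L *ᵥ z := by
    intro z
    simp only [dotProduct, hLz, ← Finset.sum_sub_distrib]
    exact Finset.sum_congr rfl fun i _ => by ring
  have hLboch : ∀ y : ι → ℝ, y ⬝ᵥ L *ᵥ y ≤ ∑ i, (L *ᵥ y) i ^ 2 / w i := by
    intro y
    have h := hboch y
    have e : ∑ i, v i * (M *ᵥ y) i ^ 2 / (M *ᵥ v) i =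
        ∑ i, w i * y i ^ 2 - 2 * (y ⬝ᵥ L *ᵥ y) + ∑ i, (L *ᵥ y) i ^ 2 / w i := by
      simp only [dotProduct, Finset.mul_sum, ← Finset.sum_sub_distrib, ← Finset.sum_add_distrib]
      refine Finset.sum_congr rfl fun i _ => ?_
      have hMy : (M *ᵥ y) i = w i * y i - (L *ᵥ y) i := by rw [hLz]; ring
      rw [hMy, ← hwv i]
      have h1 := (hv i).ne'
      have h2 := (hwpos i).ne'
      field_simp
      ring
    rw [e, hMz] at h
    linarith
  have horth : ∀ z : ι → ℝ, (M *ᵥ v) ⬝ᵥ z = 0 → z ⬝ᵥ M *ᵥ z ≤ 0 := by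
    intro z hz
    obtain ⟨u, hu⟩ := hL.exists_mulVec_eq (fun i => w i * z i) (by
      intro k hk
      obtain ⟨c, rfl⟩ := hker k hk
      rw [smul_dotProduct]
      have : v ⬝ᵥ (fun i => w i * z i) = (M *ᵥ v) ⬝ᵥ z := by
        simp only [dotProduct, ← hwv]
        exact Finset.sum_congr rfl fun i _ => by ring
      rw [this, hz, smul_zero])
    set n := ∑ i, w i * z i ^ 2 with hn
    have hn0 : 0 ≤ n := Finset.sum_nonneg fun i _ => mul_nonneg (hwpos i).le (sq_nonneg _)
    have h1 : u ⬝ᵥ L *ᵥ u ≤ n := by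
      refine (hLboch u).trans_eq (Finset.sum_congr rfl fun i _ => ?_)
      rw [hu]
      have h2 := (hwpos i).ne'
      field_simp
    have h2 : u ⬝ᵥ L *ᵥ z = n := by
      rw [hL.dotProduct_mulVec_comm, hu]
      exact Finset.sum_congr rfl fun i _ => by ring
    have h3 := hL.sq_dotProduct_mulVec_le hLpos u z
    rw [h2] at h3
    have h4 := hLpos z
    rw [hMz]
    rcases hn0.eq_or_lt with h | h
    · linarith
    · have h5 : n * n ≤ n * (z ⬝ᵥ L *ᵥ z) := by nlinarith
      have := le_of_mul_le_mul_left h5 h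
      linarith
  set m := v ⬝ᵥ M *ᵥ v with hm
  have hmpos : 0 < m := Finset.sum_pos (fun i _ => mul_pos (hv i) (hMv i)) Finset.univ_nonempty
  set c := (v ⬝ᵥ M *ᵥ z) / m with hc
  have hcm : v ⬝ᵥ M *ᵥ z = c * m := (div_mul_cancel₀ _ hmpos.ne').symm
  have h := horth (z - c • v) (by
    rw [dotProduct_comm, hM.dotProduct_mulVec_comm, mulVec_sub, mulVec_smul, dotProduct_sub,
      dotProduct_smul, smul_eq_mul, hcm]
    ring)
  simp only [mulVec_sub, mulVec_smul, dotProduct_sub, sub_dotProduct, smul_dotProduct,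
    dotProduct_smul, smul_eq_mul, hM.dotProduct_mulVec_comm z v, hcm, ← hm] at h
  rw [hcm]
  nlinarith

end LinearAlgebra

section Volume

open MvPolynomial

section Directional

variable {σ : Type*} [Fintype σ]

/-- The directional derivative of a polynomial along the vector `y`. -/
noncomputable def MvPolynomial.dirDeriv (y : σ → ℝ) :
    Derivation ℝ (MvPolynomial σ ℝ) (MvPolynomial σ ℝ) :=
  ∑ i, y i • pderiv i

theorem MvPolynomial.dirDeriv_apply (y : σ → ℝ) (p : MvPolynomial σ ℝ) :
    dirDeriv y p = ∑ i, y i • pderiv i p := by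
  have h := map_sum (Derivation.coeFnAddMonoidHom (R := ℝ) (A := MvPolynomial σ ℝ)
    (M := MvPolynomial σ ℝ)) (fun i => y i • pderiv i) Finset.univ
  have := congrFun h p
  rw [Finset.sum_apply] at this
  exact this

theorem MvPolynomial.dirDeriv_mul (y : σ → ℝ) (p q : MvPolynomial σ ℝ) :
    dirDeriv y (p * q) = dirDeriv y p * q + p * dirDeriv y q := by
  rw [Derivation.leibniz, smul_eq_mul, smul_eq_mul]
  ring

@[simp] theorem MvPolynomial.dirDeriv_C (y : σ → ℝ) (c : ℝ) :
    dirDeriv y (MvPolynomial.C c : MvPolynomial σ ℝ) = 0 :=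
  Derivation.map_algebraMap _ _

omit [Fintype σ] in
theorem MvPolynomial.pderiv_pderiv_comm (i j : σ) (p : MvPolynomial σ ℝ) :
    pderiv i (pderiv j p) = pderiv j (pderiv i p) := by
  classical
  have h : ⁅(pderiv i : Derivation ℝ (MvPolynomial σ ℝ) (MvPolynomial σ ℝ)),
      (pderiv j : Derivation ℝ (MvPolynomial σ ℝ) (MvPolynomial σ ℝ))⁆ = 0 := by
    refine MvPolynomial.derivation_ext fun k => ?_
    rw [Derivation.commutator_apply]
    simp [pderiv_X, Pi.single_apply, apply_ite]
  have := congrArg (fun d => d p) h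
  simpa [Derivation.commutator_apply, sub_eq_zero] using this

theorem MvPolynomial.pderiv_dirDeriv_comm (i : σ) (y : σ → ℝ) (p : MvPolynomial σ ℝ) :
    pderiv i (dirDeriv y p) = dirDeriv y (pderiv i p) := by
  simp_rw [dirDeriv_apply, map_sum, Derivation.map_smul, pderiv_pderiv_comm i]

@[simp] theorem MvPolynomial.dirDeriv_X (y : σ → ℝ) (i : σ) :
    dirDeriv y (MvPolynomial.X i) = MvPolynomial.C (y i) := by
  classical
  simp [dirDeriv_apply, pderiv_X, Pi.single_apply, MvPolynomial.smul_eq_C_mul]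

theorem MvPolynomial.IsHomogeneous.dirDeriv {p : MvPolynomial σ ℝ} {n : ℕ}
    (h : p.IsHomogeneous n) (y : σ → ℝ) : (dirDeriv y p).IsHomogeneous (n - 1) := by
  rw [dirDeriv_apply]
  refine IsHomogeneous.sum _ _ _ fun i _ => ?_
  rw [MvPolynomial.smul_eq_C_mul]
  simpa using (isHomogeneous_C σ (y i)).mul h.pderiv

theorem MvPolynomial.IsHomogeneous.eval_dirDeriv_self {p : MvPolynomial σ ℝ} {n : ℕ}
    (h : p.IsHomogeneous n) (t : σ → ℝ) : eval t (MvPolynomial.dirDeriv t p) = n * eval t p := by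
  have := congrArg (eval t) h.sum_X_mul_pderiv
  simpa [dirDeriv_apply, MvPolynomial.smul_eval] using this

end Directional

/-- A graded family of finite sets, such as the flats of a matroid, in which the sets covering
`F` inside `G` partition `G \ F`. -/
structure FlatSystem (α : Type*) where
  flats : Finset (Finset α)
  rk : Finset α → ℕ
  rk_lt : ∀ F ∈ flats, ∀ G ∈ flats, F ⊂ G → rk F < rk G
  cover : ∀ F ∈ flats, ∀ G ∈ flats, F ⊂ G → ∀ a ∈ G, a ∉ F →
    ∃! H, H ∈ flats ∧ F ⊆ H ∧ H ⊆ G ∧ a ∈ H ∧ rk H = rk F + 1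

/-- The weight of `F` in the interpolation of the cardinality function between `F` and `G`. -/
noncomputable def interpWeight {α : Type*} (F G H : Finset α) : ℝ :=
  ((G.card : ℝ) - H.card) / ((G.card : ℝ) - F.card)

/-- The function `y` normalized to vanish at `F` and `G` by subtracting a function that is affine
in the cardinality. -/
noncomputable def normalizeAt {α : Type*} (F G : Finset α) (y : Finset α → ℝ) (H : Finset α) : ℝ :=
  y H - interpWeight F G H * y F - (1 - interpWeight F G H) * y G

namespace FlatSystem

variable {α : Type*}

/-- The coordinate `X H` normalized in the interval from `F` to `G`. -/
noncomputable def normX (F G H : Finset α) : MvPolynomial (Finset α) ℝ :=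
  MvPolynomial.X H - MvPolynomial.C (interpWeight F G H) * MvPolynomial.X F -
    MvPolynomial.C (1 - interpWeight F G H) * MvPolynomial.X G

theorem isHomogeneous_normX (F G H : Finset α) : (normX F G H).IsHomogeneous 1 := by
  refine ((isHomogeneous_X _ _).sub ?_).sub ?_
  · simpa using (isHomogeneous_C _ (interpWeight F G H)).mul (isHomogeneous_X ℝ F)
  · simpa using (isHomogeneous_C _ (1 - interpWeight F G H)).mul (isHomogeneous_X ℝ G)

theorem eval_normX (F G H : Finset α) (t : Finset α → ℝ) :
    eval t (normX F G H) = normalizeAt F G t H := by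
  simp [normX, normalizeAt]

theorem normalizeAt_affine {F G : Finset α} (hFG : F ⊂ G) (a b : ℝ) (H : Finset α) :
    normalizeAt F G (fun K => a + b * K.card) H = 0 := by
  have h : (G.card : ℝ) - F.card ≠ 0 := by
    have : (F.card : ℝ) < G.card := by exact_mod_cast Finset.card_lt_card hFG
    linarith
  simp only [normalizeAt, interpWeight]
  field_simp
  ring

section

variable [Fintype α]

theorem dirDeriv_normX (F G H : Finset α) (y : Finset α → ℝ) :
    dirDeriv y (normX F G H) = MvPolynomial.C (normalizeAt F G y H) := by
  simp [normX, normalizeAt]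

end

variable [DecidableEq α] (S : FlatSystem α)

/-- The flats strictly between `F` and `G`. -/
def between (F G : Finset α) : Finset (Finset α) := S.flats.filter fun H => F ⊂ H ∧ H ⊂ G

variable {S} in
@[simp] theorem mem_between {F G H : Finset α} :
    H ∈ S.between F G ↔ H ∈ S.flats ∧ F ⊂ H ∧ H ⊂ G := by
  simp [between]

/-- The degree of the volume polynomial of the interval from `F` to `G`. -/
def deg (F G : Finset α) : ℕ := S.rk G - S.rk F - 1

/-- The volume polynomial of the interval from `F` to `G`. -/
noncomputable def vol (F G : Finset α) : MvPolynomial (Finset α) ℝ :=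
  if S.deg F G = 0 then 1 else
    MvPolynomial.C ((S.deg F G : ℝ)⁻¹) * ∑ H ∈ (S.between F G).attach,
      (MvPolynomial.X H.1 - MvPolynomial.C (interpWeight F G H.1) * MvPolynomial.X F -
        MvPolynomial.C (1 - interpWeight F G H.1) * MvPolynomial.X G) *
        (vol F H.1 * vol H.1 G)
termination_by G.card - F.card
decreasing_by
  · have h := mem_between.1 H.2
    have h1 := Finset.card_lt_card h.2.1
    have h2 := Finset.card_lt_card h.2.2
    omega
  · have h := mem_between.1 H.2
    have h1 := Finset.card_lt_card h.2.1
    have h2 := Finset.card_lt_card h.2.2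
    omega

theorem vol_of_deg_eq_zero {F G : Finset α} (h : S.deg F G = 0) : S.vol F G = 1 := by
  rw [vol, if_pos h]

theorem vol_of_deg_ne_zero {F G : Finset α} (h : S.deg F G ≠ 0) : S.vol F G =
    MvPolynomial.C ((S.deg F G : ℝ)⁻¹) *
      ∑ H ∈ S.between F G, normX F G H * (S.vol F H * S.vol H G) := by
  rw [vol, if_neg h]
  congr 1
  exact Finset.sum_attach (S.between F G) fun H => normX F G H * (S.vol F H * S.vol H G)

theorem deg_smul_vol {F G : Finset α} (h : S.deg F G ≠ 0) : (S.deg F G : ℝ) • S.vol F G =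
    ∑ H ∈ S.between F G, normX F G H * (S.vol F H * S.vol H G) := by
  rw [S.vol_of_deg_ne_zero h, MvPolynomial.smul_eq_C_mul, ← mul_assoc, ← MvPolynomial.C_mul,
    mul_inv_cancel₀ (Nat.cast_ne_zero.2 h), MvPolynomial.C_1, one_mul]

/-- Induction over intervals of a flat system. -/
theorem interval_induction {P : Finset α → Finset α → Prop}
    (h : ∀ F ∈ S.flats, ∀ G ∈ S.flats, F ⊂ G →
      (∀ H ∈ S.between F G, P F H ∧ P H G) → P F G) :
    ∀ F ∈ S.flats, ∀ G ∈ S.flats, F ⊂ G → P F G := by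
  have key : ∀ n : ℕ, ∀ F ∈ S.flats, ∀ G ∈ S.flats, F ⊂ G → S.rk G - S.rk F = n → P F G := by
    intro n
    induction n using Nat.strong_induction_on with
    | _ n ih =>
      intro F hF G hG hFG hn
      refine h F hF G hG hFG fun H hH => ?_
      obtain ⟨hH, h1, h2⟩ := mem_between.1 hH
      have r1 := S.rk_lt F hF H hH h1
      have r2 := S.rk_lt H hH G hG h2
      exact ⟨ih _ (by omega) F hF H hH h1 rfl, ih _ (by omega) H hH G hG h2 rfl⟩
  exact fun F hF G hG hFG => key _ F hF G hG hFG rfl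

variable {S} in
theorem deg_add {F G H : Finset α} (hF : F ∈ S.flats) (hG : G ∈ S.flats) (hH : H ∈ S.between F G) :
    S.deg F H + S.deg H G + 1 = S.deg F G := by
  obtain ⟨hH, h1, h2⟩ := mem_between.1 hH
  have r1 := S.rk_lt F hF H hH h1
  have r2 := S.rk_lt H hH G hG h2
  simp only [deg]
  omega

theorem isHomogeneous_vol :
    ∀ F ∈ S.flats, ∀ G ∈ S.flats, F ⊂ G → (S.vol F G).IsHomogeneous (S.deg F G) := by
  refine S.interval_induction fun F hF G hG _ ih => ?_
  by_cases h : S.deg F G = 0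
  · rw [S.vol_of_deg_eq_zero h, h]
    exact isHomogeneous_one _ _
  · rw [S.vol_of_deg_ne_zero h]
    have : (∑ H ∈ S.between F G, normX F G H * (S.vol F H * S.vol H G)).IsHomogeneous
        (S.deg F G) := by
      refine IsHomogeneous.sum _ _ _ fun H hH => ?_
      have := (isHomogeneous_normX F G H).mul ((ih H hH).1.mul (ih H hH).2)
      rwa [add_comm, deg_add hF hG hH] at this
    simpa using (isHomogeneous_C _ ((S.deg F G : ℝ)⁻¹)).mul this

theorem pderiv_vol_eq_zero : ∀ F ∈ S.flats, ∀ G ∈ S.flats, F ⊂ G →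
    ∀ K, K ∉ S.between F G → K ≠ F → K ≠ G → pderiv K (S.vol F G) = 0 := by
  refine S.interval_induction fun F hF G hG _ ih K hK hKF hKG => ?_
  by_cases h : S.deg F G = 0
  · rw [S.vol_of_deg_eq_zero h, pderiv_one]
  · rw [S.vol_of_deg_ne_zero h, pderiv_C_mul, map_sum,
      Finset.sum_eq_zero, mul_zero]
    intro H hH
    have hKH : K ≠ H := fun e => hK (e ▸ hH)
    have hH' := mem_between.1 hH
    have e1 : pderiv K (S.vol F H) = 0 := (ih H hH).1 K (fun h => hK (by
      rw [mem_between] at h ⊢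
      exact ⟨h.1, h.2.1, h.2.2.trans hH'.2.2⟩)) hKF hKH
    have e2 : pderiv K (S.vol H G) = 0 := (ih H hH).2 K (fun h => hK (by
      rw [mem_between] at h ⊢
      exact ⟨h.1, hH'.2.1.trans h.2.1, h.2.2⟩)) hKH hKG
    simp [normX, e1, e2, pderiv_X_of_ne hKH.symm, pderiv_X_of_ne hKF.symm,
      pderiv_X_of_ne hKG.symm]

/-- The product of the volume polynomials of the intervals below and above `H`. -/
noncomputable def prodVol (F G H : Finset α) : MvPolynomial (Finset α) ℝ :=
  S.vol F H * S.vol H G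

theorem isHomogeneous_prodVol {F G H : Finset α} (hF : F ∈ S.flats) (hG : G ∈ S.flats)
    (hH : H ∈ S.between F G) : (S.prodVol F G H).IsHomogeneous (S.deg F G - 1) := by
  obtain ⟨hH', h1, h2⟩ := mem_between.1 hH
  have := (S.isHomogeneous_vol F hF H hH' h1).mul (S.isHomogeneous_vol H hH' G hG h2)
  rwa [← deg_add hF hG hH, Nat.add_sub_cancel]

variable [Fintype α]

theorem dirDeriv_vol_affine (a b : ℝ) : ∀ F ∈ S.flats, ∀ G ∈ S.flats, F ⊂ G →
    dirDeriv (fun K => a + b * K.card) (S.vol F G) = 0 := by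
  refine S.interval_induction fun F hF G hG hFG ih => ?_
  by_cases h : S.deg F G = 0
  · rw [S.vol_of_deg_eq_zero h, Derivation.map_one_eq_zero]
  · rw [S.vol_of_deg_ne_zero h, dirDeriv_mul, dirDeriv_C, zero_mul, zero_add, map_sum,
      Finset.sum_eq_zero, mul_zero]
    intro H hH
    rw [dirDeriv_mul, dirDeriv_mul, (ih H hH).1, (ih H hH).2, dirDeriv_normX,
      normalizeAt_affine hFG]
    simp

theorem sum_univ_eq_sum_between {F G : Finset α} (hFG : F ≠ G) {A : Type*} [AddCommMonoid A]
    (f : Finset α → A) (hf : ∀ K, K ∉ S.between F G → K ≠ F → K ≠ G → f K = 0) :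
    ∑ K, f K = f F + (f G + ∑ K ∈ S.between F G, f K) := by
  have h1 : G ∉ S.between F G := fun h => (mem_between.1 h).2.2.ne rfl
  have h2 : F ∉ insert G (S.between F G) := by
    rw [Finset.mem_insert, not_or]
    exact ⟨hFG, fun h => (mem_between.1 h).2.1.ne rfl⟩
  rw [← Finset.sum_insert h1, ← Finset.sum_insert h2]
  symm
  refine Finset.sum_subset (Finset.subset_univ _) fun K _ hK => ?_
  simp only [Finset.mem_insert, not_or] at hK
  exact hf K hK.2.2 hK.1 hK.2.1

/-- A polynomial in the variables indexed by the interval from `F` to `G` that is invariant under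
translation by functions affine in the cardinality. -/
structure IsIntervalPoly (F G : Finset α) (U : MvPolynomial (Finset α) ℝ) : Prop where
  pderiv_eq_zero : ∀ K, K ∉ S.between F G → K ≠ F → K ≠ G → pderiv K U = 0
  dirDeriv_affine : ∀ a b : ℝ, dirDeriv (fun K => a + b * K.card) U = 0

theorem isIntervalPoly_vol {F G : Finset α} (hF : F ∈ S.flats) (hG : G ∈ S.flats) (hFG : F ⊂ G) :
    S.IsIntervalPoly F G (S.vol F G) :=
  ⟨S.pderiv_vol_eq_zero F hF G hG hFG, fun a b => S.dirDeriv_vol_affine a b F hF G hG hFG⟩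

theorem isIntervalPoly_prodVol {F G H : Finset α} (hF : F ∈ S.flats) (hG : G ∈ S.flats)
    (hH : H ∈ S.between F G) : S.IsIntervalPoly F G (S.prodVol F G H) := by
  obtain ⟨hH', h1, h2⟩ := mem_between.1 hH
  have p1 := S.isIntervalPoly_vol hF hH' h1
  have p2 := S.isIntervalPoly_vol hH' hG h2
  constructor
  · intro K hK hKF hKG
    have hKH : K ≠ H := fun e => hK (e ▸ hH)
    rw [prodVol, pderiv_mul, p1.pderiv_eq_zero K _ hKF hKH, p2.pderiv_eq_zero K _ hKH hKG]
    · simp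
    · exact fun h => hK (mem_between.2 ⟨(mem_between.1 h).1, h1.trans (mem_between.1 h).2.1,
        (mem_between.1 h).2.2⟩)
    · exact fun h => hK (mem_between.2 ⟨(mem_between.1 h).1, (mem_between.1 h).2.1,
        (mem_between.1 h).2.2.trans h2⟩)
  · intro a b
    rw [prodVol, dirDeriv_mul, p1.dirDeriv_affine, p2.dirDeriv_affine]
    simp

variable {S} in
theorem IsIntervalPoly.sum_between {F G : Finset α} {U : MvPolynomial (Finset α) ℝ}
    (hU : S.IsIntervalPoly F G U) (hFG : F ⊂ G) (c : Finset α → MvPolynomial (Finset α) ℝ) :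
    ∑ H ∈ S.between F G,
      (c H - MvPolynomial.C (interpWeight F G H) * c F -
        MvPolynomial.C (1 - interpWeight F G H) * c G) * pderiv H U =
    ∑ H, c H * pderiv H U := by
  have hcard : (G.card : ℝ) - F.card ≠ 0 := by
    have : (F.card : ℝ) < G.card := by exact_mod_cast Finset.card_lt_card hFG
    linarith
  have hw : ∀ a b : ℝ, pderiv F U * MvPolynomial.C (a + b * F.card) +
      (pderiv G U * MvPolynomial.C (a + b * G.card) +
      ∑ H ∈ S.between F G, pderiv H U * MvPolynomial.C (a + b * H.card)) = 0 := by
    intro a b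
    rw [← hU.dirDeriv_affine a b, dirDeriv_apply, S.sum_univ_eq_sum_between hFG.ne
      (fun K => (a + b * (K.card : ℝ)) • pderiv K U)
      (fun K h1 h2 h3 => by rw [hU.pderiv_eq_zero K h1 h2 h3, smul_zero])]
    simp only [MvPolynomial.smul_eq_C_mul, mul_comm]
  have w1 := hw (G.card / (G.card - F.card)) (-1 / (G.card - F.card))
  have w2 := hw (-F.card / (G.card - F.card)) (1 / (G.card - F.card))
  have e1 : ∀ H : Finset α, (G.card / (G.card - F.card) + -1 / (G.card - F.card) * H.card : ℝ) =
      interpWeight F G H := fun H => by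
    simp only [interpWeight]; field_simp; ring
  have e2 : ∀ H : Finset α, (-F.card / (G.card - F.card) + 1 / (G.card - F.card) * H.card : ℝ) =
      1 - interpWeight F G H := fun H => by
    simp only [interpWeight]; field_simp; ring
  have f1 : interpWeight F G F = 1 := div_self hcard
  have f2 : interpWeight F G G = 0 := by simp [interpWeight]
  simp only [e1, f1, f2, MvPolynomial.C_0, MvPolynomial.C_1, mul_one, mul_zero, zero_add] at w1
  simp only [e2, f1, f2, sub_self, sub_zero, MvPolynomial.C_0, MvPolynomial.C_1, mul_one, mul_zero,
    zero_add] at w2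
  rw [S.sum_univ_eq_sum_between hFG.ne (fun K => c K * pderiv K U)
    (fun K h1 h2 h3 => by rw [hU.pderiv_eq_zero K h1 h2 h3, mul_zero])]
  have e3 : ∀ H, (c H - MvPolynomial.C (interpWeight F G H) * c F -
      MvPolynomial.C (1 - interpWeight F G H) * c G) *
      pderiv H U = c H * pderiv H U - c F * (pderiv H U * MvPolynomial.C (interpWeight F G H)) -
        c G * (pderiv H U * MvPolynomial.C (1 - interpWeight F G H)) := fun H => by ring
  simp_rw [e3, Finset.sum_sub_distrib, ← Finset.mul_sum]
  linear_combination (-c F) * w1 - c G * w2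

variable {S} in
theorem IsIntervalPoly.dirDeriv_eq {F G : Finset α} {U : MvPolynomial (Finset α) ℝ}
    (hU : S.IsIntervalPoly F G U) (hFG : F ⊂ G) (y : Finset α → ℝ) :
    dirDeriv y U = ∑ H ∈ S.between F G, MvPolynomial.C (normalizeAt F G y H) * pderiv H U := by
  have := hU.sum_between hFG (fun H => MvPolynomial.C (y H))
  simp_rw [dirDeriv_apply, MvPolynomial.smul_eq_C_mul, ← this, normalizeAt, MvPolynomial.C_sub,
    MvPolynomial.C_mul, MvPolynomial.C_sub]

variable {S} in
theorem IsIntervalPoly.sum_normX_mul_pderiv {F G : Finset α} {U : MvPolynomial (Finset α) ℝ}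
    (hU : S.IsIntervalPoly F G U) (hFG : F ⊂ G) {n : ℕ} (hn : U.IsHomogeneous n) :
    ∑ H ∈ S.between F G, normX F G H * pderiv H U = n • U := by
  rw [← hn.sum_X_mul_pderiv, ← hU.sum_between hFG]
  rfl

/-- The derivative of the volume polynomial along an interior flat is the product of the volume
polynomials of the two smaller intervals. -/
theorem pderiv_vol : ∀ F ∈ S.flats, ∀ G ∈ S.flats, F ⊂ G → ∀ K ∈ S.between F G,
    pderiv K (S.vol F G) = S.prodVol F G K := by
  refine S.interval_induction fun F hF G hG hFG ih K hK => ?_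
  have hd : S.deg F G ≠ 0 := by
    have := deg_add hF hG hK
    omega
  have below : ∀ H ∈ S.between F G, ∀ K ∈ S.between F G, K ⊂ H →
      pderiv K (S.prodVol F G H) = S.vol F K * S.vol K H * S.vol H G ∧
      pderiv H (S.prodVol F G K) = S.vol F K * S.vol K H * S.vol H G := by
    intro H hH K hK hKH
    obtain ⟨hH', h1, h2⟩ := mem_between.1 hH
    obtain ⟨hK', h3, h4⟩ := mem_between.1 hK
    constructor
    · rw [prodVol, pderiv_mul, (ih H hH).1 K (mem_between.2 ⟨hK', h3, hKH⟩),
        S.pderiv_vol_eq_zero H hH' G hG h2 K (fun h => (mem_between.1 h).2.1.not_subset hKH.subset)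
        hKH.ne h4.ne, prodVol]
      ring
    · rw [prodVol, pderiv_mul, (ih K hK).2 H (mem_between.2 ⟨hH', hKH, h2⟩),
        S.pderiv_vol_eq_zero F hF K hK' h3 H (fun h => (mem_between.1 h).2.2.not_subset hKH.subset)
        h1.ne' hKH.ne', prodVol]
      ring
  have incomp : ∀ H ∈ S.between F G, ∀ K ∈ S.between F G, H ≠ K → ¬ K ⊂ H → ¬ H ⊂ K →
      pderiv K (S.prodVol F G H) = 0 := by
    intro H hH K hK hne hKH hHK
    obtain ⟨hH', h1, h2⟩ := mem_between.1 hH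
    obtain ⟨hK', h3, h4⟩ := mem_between.1 hK
    rw [prodVol, pderiv_mul,
      S.pderiv_vol_eq_zero F hF H hH' h1 K (fun h => hKH (mem_between.1 h).2.2) h3.ne' hne.symm,
      S.pderiv_vol_eq_zero H hH' G hG h2 K (fun h => hHK (mem_between.1 h).2.1) hne.symm h4.ne]
    simp
  have symm : ∀ H ∈ S.between F G,
      pderiv K (S.prodVol F G H) = pderiv H (S.prodVol F G K) := by
    intro H hH
    by_cases hne : H = K
    · rw [hne]
    by_cases h1 : K ⊂ H
    · rw [(below H hH K hK h1).1, (below H hH K hK h1).2]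
    by_cases h2 : H ⊂ K
    · rw [(below K hK H hH h2).1, (below K hK H hH h2).2]
    · rw [incomp H hH K hK hne h1 h2, incomp K hK H hH (Ne.symm hne) h2 h1]
  have hnorm : ∀ H ∈ S.between F G, pderiv K (normX F G H) = if H = K then 1 else 0 := by
    intro H _
    have h3 := (mem_between.1 hK).2.1.ne
    have h4 := (mem_between.1 hK).2.2.ne'
    by_cases h : H = K
    · subst h
      simp [normX, pderiv_X_of_ne h3, pderiv_X_of_ne h4]
    · simp [normX, pderiv_X_of_ne h3, pderiv_X_of_ne h4, h, pderiv_X_of_ne h]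
  have key : (S.deg F G : ℝ) • pderiv K (S.vol F G) = (S.deg F G : ℝ) • S.prodVol F G K := by
    rw [← Derivation.map_smul, S.deg_smul_vol hd, map_sum]
    have : ∀ H ∈ S.between F G, pderiv K (normX F G H * (S.vol F H * S.vol H G)) =
        (if H = K then S.prodVol F G K else 0) + normX F G H * pderiv H (S.prodVol F G K) := by
      intro H hH
      rw [pderiv_mul, hnorm H hH, ← symm H hH, prodVol]
      split_ifs with h
      · rw [h, one_mul, prodVol]
      · rw [zero_mul]; rfl
    rw [Finset.sum_congr rfl this, Finset.sum_add_distrib, Finset.sum_ite_eq' , if_pos hK,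
      (S.isIntervalPoly_prodVol hF hG hK).sum_normX_mul_pderiv hFG
        (S.isHomogeneous_prodVol hF hG hK), ← Nat.cast_smul_eq_nsmul ℝ,
      Nat.cast_sub (Nat.one_le_iff_ne_zero.2 hd), sub_smul]
    simp
  exact smul_right_injective _ (Nat.cast_ne_zero.2 hd) key

theorem dirDeriv_vol {F G : Finset α} (hF : F ∈ S.flats) (hG : G ∈ S.flats) (hFG : F ⊂ G)
    (y : Finset α → ℝ) :
    dirDeriv y (S.vol F G) =
      ∑ H ∈ S.between F G, MvPolynomial.C (normalizeAt F G y H) * S.prodVol F G H := by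
  rw [(S.isIntervalPoly_vol hF hG hFG).dirDeriv_eq hFG]
  exact Finset.sum_congr rfl fun H hH => by rw [S.pderiv_vol F hF G hG hFG H hH]

end FlatSystem

section Lorentzian

theorem reversed_cauchy_schwarz_sub_sum {ι : Type*} (s : Finset ι) (a a' : ℝ) (b b' : ι → ℝ)
    (h : 0 < a * a - ∑ i ∈ s, b i * b i) :
    (a * a - ∑ i ∈ s, b i * b i) * (a' * a' - ∑ i ∈ s, b' i * b' i) ≤
      (a * a' - ∑ i ∈ s, b i * b' i) ^ 2 := by
  set Q := a * a - ∑ i ∈ s, b i * b i with hQ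
  set R := a' * a' - ∑ i ∈ s, b' i * b' i with hR
  set T := a * a' - ∑ i ∈ s, b i * b' i with hT
  have h1 : 0 ≤ ∑ i ∈ s, (a' * b i - a * b' i) ^ 2 := Finset.sum_nonneg fun i _ => sq_nonneg _
  have h2 : ∑ i ∈ s, (a' * b i - a * b' i) ^ 2 = a' ^ 2 * ∑ i ∈ s, b i * b i -
      2 * a * a' * ∑ i ∈ s, b i * b' i + a ^ 2 * ∑ i ∈ s, b' i * b' i := by
    simp only [Finset.mul_sum, ← Finset.sum_sub_distrib, ← Finset.sum_add_distrib]
    exact Finset.sum_congr rfl fun i _ => by ring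
  have h3 : a' ^ 2 * Q - 2 * a * a' * T + a ^ 2 * R ≤ 0 := by
    rw [hQ, hR, hT]; nlinarith
  have h4 : 0 < a ^ 2 := by
    have : 0 ≤ ∑ i ∈ s, b i * b i := Finset.sum_nonneg fun i _ => mul_self_nonneg _
    nlinarith
  have h5 : a ^ 2 * (Q * R) ≤ a ^ 2 * T ^ 2 := by
    nlinarith [mul_le_mul_of_nonneg_left h3 h.le, sq_nonneg (a * T - a' * Q)]
  exact le_of_mul_le_mul_left h5 h4

variable {σ : Type*} [Fintype σ]

theorem MvPolynomial.dirDeriv_comm (y z : σ → ℝ) (p : MvPolynomial σ ℝ) :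
    dirDeriv y (dirDeriv z p) = dirDeriv z (dirDeriv y p) := by
  rw [dirDeriv_apply, dirDeriv_apply y p, map_sum]
  exact Finset.sum_congr rfl fun i _ => by rw [pderiv_dirDeriv_comm, Derivation.map_smul]

/-- The infinitesimal form, at the point `t`, of the concavity of the `n`-th root of `p`. -/
def MvPolynomial.RootConcaveAt (t : σ → ℝ) (n : ℕ) (p : MvPolynomial σ ℝ) : Prop :=
  ∀ y : σ → ℝ, n * eval t p * eval t (dirDeriv y (dirDeriv y p)) ≤
    (n - 1) * eval t (dirDeriv y p) ^ 2

theorem MvPolynomial.RootConcaveAt.mul {t : σ → ℝ} {m n : ℕ} {p q : MvPolynomial σ ℝ}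
    (hp : RootConcaveAt t m p) (hq : RootConcaveAt t n q) (hm : m = 0 → p = 1)
    (hn : n = 0 → q = 1) : RootConcaveAt t (m + n) (p * q) := by
  rcases Nat.eq_zero_or_pos m with h | hm'
  · rw [h, hm h, one_mul, zero_add]; exact hq
  rcases Nat.eq_zero_or_pos n with h | hn'
  · rw [h, hn h, mul_one, add_zero]; exact hp
  intro y
  have h1 := hp y
  have h2 := hq y
  simp only [dirDeriv_mul, map_add, map_mul, Nat.cast_add]
  set P := eval t p
  set Q := eval t q
  set P' := eval t (dirDeriv y p)
  set Q' := eval t (dirDeriv y q)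
  set P'' := eval t (dirDeriv y (dirDeriv y p))
  set Q'' := eval t (dirDeriv y (dirDeriv y q))
  have hm0 : (0 : ℝ) < m := by exact_mod_cast hm'
  have hn0 : (0 : ℝ) < n := by exact_mod_cast hn'
  have h1' : P * P'' ≤ (1 - 1 / m) * P' ^ 2 := by
    have : m * (P * P'') ≤ m * ((1 - 1 / m) * P' ^ 2) := by
      rw [← mul_assoc, ← mul_assoc, mul_sub, mul_one, mul_one_div_cancel hm0.ne']
      exact h1
    exact le_of_mul_le_mul_left this hm0
  have h2' : Q * Q'' ≤ (1 - 1 / n) * Q' ^ 2 := by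
    have : n * (Q * Q'') ≤ n * ((1 - 1 / n) * Q' ^ 2) := by
      rw [← mul_assoc, ← mul_assoc, mul_sub, mul_one, mul_one_div_cancel hn0.ne']
      exact h2
    exact le_of_mul_le_mul_left this hn0
  have h3 : Q ^ 2 * (P * P'') ≤ Q ^ 2 * ((1 - 1 / m) * P' ^ 2) :=
    mul_le_mul_of_nonneg_left h1' (sq_nonneg _)
  have h4 : P ^ 2 * (Q * Q'') ≤ P ^ 2 * ((1 - 1 / n) * Q' ^ 2) :=
    mul_le_mul_of_nonneg_left h2' (sq_nonneg _)
  have h5 : (P' * Q + P * Q') ^ 2 ≤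
      ((m : ℝ) + n) * ((Q * P') ^ 2 / m + (P * Q') ^ 2 / n) := by
    have e : ((m : ℝ) + n) * ((Q * P') ^ 2 / m + (P * Q') ^ 2 / n) - (P' * Q + P * Q') ^ 2 =
        (n * (Q * P') - m * (P * Q')) ^ 2 / (m * n) := by
      field_simp
      ring
    have : 0 ≤ (n * (Q * P') - m * (P * Q')) ^ 2 / (m * n) := by positivity
    linarith
  have h6 : ((m : ℝ) + n) * (Q ^ 2 * (P * P'') + 2 * (P * Q * P' * Q') + P ^ 2 * (Q * Q'')) ≤
      (m + n) * (Q ^ 2 * ((1 - 1 / m) * P' ^ 2) + 2 * (P * Q * P' * Q') +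
        P ^ 2 * ((1 - 1 / n) * Q' ^ 2)) :=
    mul_le_mul_of_nonneg_left (by linarith) (by positivity)
  have e7 : ((m : ℝ) + n) * (Q ^ 2 * ((1 - 1 / m) * P' ^ 2) + 2 * (P * Q * P' * Q') +
        P ^ 2 * ((1 - 1 / n) * Q' ^ 2)) = (m + n) * (P' * Q + P * Q') ^ 2 -
        (m + n) * ((Q * P') ^ 2 / m + (P * Q') ^ 2 / n) := by
    ring
  have e8 : ((m : ℝ) + n) * (P * Q) * (P'' * Q + P' * Q' + (P' * Q' + P * Q'')) =
      (m + n) * (Q ^ 2 * (P * P'') + 2 * (P * Q * P' * Q') + P ^ 2 * (Q * Q'')) := by ring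
  rw [e8]
  linarith

end Lorentzian

namespace FlatSystem

variable {α : Type*} [DecidableEq α] (S : FlatSystem α)

/-- The flats covering `F` inside `G`. -/
def covers (F G : Finset α) : Finset (Finset α) :=
  S.flats.filter fun H => F ⊂ H ∧ H ⊆ G ∧ S.rk H = S.rk F + 1

variable {S} in
theorem mem_covers {F G H : Finset α} :
    H ∈ S.covers F G ↔ H ∈ S.flats ∧ F ⊂ H ∧ H ⊆ G ∧ S.rk H = S.rk F + 1 := by
  simp [covers]

theorem exists_mem_covers {F G : Finset α} (hF : F ∈ S.flats) (hG : G ∈ S.flats) (hFG : F ⊂ G)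
    {a : α} (ha : a ∈ G) (haF : a ∉ F) : ∃ H ∈ S.covers F G, a ∈ H := by
  obtain ⟨H, ⟨h1, h2, h3, h4, h5⟩, -⟩ := S.cover F hF G hG hFG a ha haF
  exact ⟨H, mem_covers.2 ⟨h1, ⟨h2, fun h => haF (h h4)⟩, h3, h5⟩, h4⟩

theorem eq_of_mem_covers {F G H K : Finset α} (hF : F ∈ S.flats) (hG : G ∈ S.flats) (hFG : F ⊂ G)
    (hH : H ∈ S.covers F G) (hK : K ∈ S.covers F G) {a : α} (haH : a ∈ H) (haK : a ∈ K)
    (haF : a ∉ F) : H = K := by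
  obtain ⟨h1, h2, h3, h4⟩ := mem_covers.1 hH
  obtain ⟨k1, k2, k3, k4⟩ := mem_covers.1 hK
  exact (S.cover F hF G hG hFG a (h3 haH) haF).unique ⟨h1, h2.subset, h3, haH, h4⟩
    ⟨k1, k2.subset, k3, haK, k4⟩

theorem sum_covers {F G : Finset α} (hF : F ∈ S.flats) (hG : G ∈ S.flats) (hFG : F ⊂ G) :
    ∑ H ∈ S.covers F G, ((H.card : ℝ) - F.card) = G.card - F.card := by
  have h1 : (S.covers F G).biUnion (fun H => H \ F) = G \ F := by
    ext a
    simp only [Finset.mem_biUnion, Finset.mem_sdiff]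
    constructor
    · rintro ⟨H, hH, ha, haF⟩
      exact ⟨(mem_covers.1 hH).2.2.1 ha, haF⟩
    · rintro ⟨ha, haF⟩
      obtain ⟨H, hH, haH⟩ := S.exists_mem_covers hF hG hFG ha haF
      exact ⟨H, hH, haH, haF⟩
  have h2 := Finset.card_biUnion (s := S.covers F G) (t := fun H => H \ F) (by
    intro H hH K hK hne
    rw [Function.onFun, Finset.disjoint_left]
    intro a ha ha'
    rw [Finset.mem_sdiff] at ha ha'
    exact hne (S.eq_of_mem_covers hF hG hFG hH hK ha.1 ha'.1 ha.2))
  rw [h1] at h2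
  have h3 : ∀ A B : Finset α, A ⊂ B → ((B \ A).card : ℝ) = B.card - A.card := by
    intro A B h
    rw [Finset.cast_card_sdiff h.subset]
  rw [← h3 F G hFG, h2, Nat.cast_sum]
  exact Finset.sum_congr rfl fun H hH => (h3 F H (mem_covers.1 hH).2.1).symm

theorem not_subset_of_mem_covers {F G p q : Finset α} (hp : p ∈ S.covers F G)
    (hq : q ∈ S.covers F G) (hpq : p ≠ q) : ∃ a ∈ q, a ∉ p := by
  obtain ⟨p1, p2, p3, p4⟩ := mem_covers.1 hp
  obtain ⟨q1, q2, q3, q4⟩ := mem_covers.1 hq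
  by_contra! h
  have := S.rk_lt q q1 p p1 (Finset.ssubset_iff_subset_ne.2 ⟨h, hpq.symm⟩)
  omega

/-- Two distinct covers of `F` have a unique common cover. -/
theorem existsUnique_line {F G p q : Finset α} (hF : F ∈ S.flats) (hG : G ∈ S.flats)
    (hFG : F ⊂ G) (hd : 2 ≤ S.deg F G) (hp : p ∈ S.covers F G) (hq : q ∈ S.covers F G)
    (hpq : p ≠ q) : ∃! l, l ∈ S.between F G ∧ S.rk l = S.rk F + 2 ∧ p ⊂ l ∧ q ⊂ l := by
  obtain ⟨p1, p2, p3, p4⟩ := mem_covers.1 hp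
  obtain ⟨q1, q2, q3, q4⟩ := mem_covers.1 hq
  obtain ⟨a, haq, hap⟩ := S.not_subset_of_mem_covers hp hq hpq
  simp only [deg] at hd
  have haF : a ∉ F := fun h => hap (p2.subset h)
  have hpG : p ⊂ G := ⟨p3, fun h => hap (h (q3 haq))⟩
  obtain ⟨l, ⟨l1, l2, l3, l4, l5⟩, hl⟩ := S.cover p p1 G hG hpG a (q3 haq) hap
  have hpl : p ⊂ l := ⟨l2, fun h => hap (h l4)⟩
  have hFl : F ⊂ l := p2.trans hpl
  have hlG : l ⊂ G := Finset.ssubset_iff_subset_ne.2 ⟨l3, fun h => by rw [h] at l5; omega⟩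
  obtain ⟨q', hq', haq'⟩ := S.exists_mem_covers hF l1 hFl l4 haF
  obtain ⟨r1, r2, r3, r4⟩ := mem_covers.1 hq'
  have hqq' : q = q' :=
    S.eq_of_mem_covers hF hG hFG hq (mem_covers.2 ⟨r1, r2, r3.trans l3, r4⟩) haq haq' haF
  have hql : q ⊂ l := Finset.ssubset_iff_subset_ne.2 ⟨hqq' ▸ r3, fun h => by
    rw [h] at q4; omega⟩
  refine ⟨l, ⟨mem_between.2 ⟨l1, hFl, hlG⟩, by omega, hpl, hql⟩, ?_⟩
  rintro l' ⟨m1, m2, m3, m4⟩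
  obtain ⟨n1, n2, n3⟩ := mem_between.1 m1
  exact hl l' ⟨n1, m3.subset, n3.subset, m4.subset haq, by omega⟩

theorem exists_cover_subset {F G H : Finset α} (hF : F ∈ S.flats) (hH : H ∈ S.between F G) :
    ∃ p ∈ S.covers F G, p ⊆ H := by
  obtain ⟨h1, h2, h3⟩ := mem_between.1 hH
  obtain ⟨a, ha, haF⟩ := Finset.exists_of_ssubset h2
  obtain ⟨p, hp, -⟩ := S.exists_mem_covers hF h1 h2 ha haF
  obtain ⟨p1, p2, p3, p4⟩ := mem_covers.1 hp
  exact ⟨p, mem_covers.2 ⟨p1, p2, p3.trans h3.subset, p4⟩, p3⟩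

theorem mem_between_of_mem_covers {F G p : Finset α} (hd : S.deg F G ≠ 0)
    (hp : p ∈ S.covers F G) : p ∈ S.between F G := by
  obtain ⟨p1, p2, p3, p4⟩ := mem_covers.1 hp
  refine mem_between.2 ⟨p1, p2, Finset.ssubset_iff_subset_ne.2 ⟨p3, fun h => ?_⟩⟩
  simp only [deg, ← h] at hd
  omega

theorem between_nonempty {F G : Finset α} (hF : F ∈ S.flats) (hG : G ∈ S.flats) (hFG : F ⊂ G)
    (hd : S.deg F G ≠ 0) : (S.between F G).Nonempty := by
  obtain ⟨a, ha, haF⟩ := Finset.exists_of_ssubset hFG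
  obtain ⟨p, hp, -⟩ := S.exists_mem_covers hF hG hFG ha haF
  exact ⟨p, S.mem_between_of_mem_covers hd hp⟩

/-- Comparability connects the flats strictly between `F` and `G`. -/
theorem between_connected {F G : Finset α} (hF : F ∈ S.flats) (hG : G ∈ S.flats)
    (hFG : F ⊂ G) (hd : 2 ≤ S.deg F G) {A : Type*} (c : Finset α → A)
    (hc : ∀ H ∈ S.between F G, ∀ K ∈ S.between F G, H ⊂ K → c H = c K) :
    ∀ H ∈ S.between F G, ∀ K ∈ S.between F G, c H = c K := by
  have hd0 : S.deg F G ≠ 0 := by omega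
  have hc' : ∀ H ∈ S.between F G, ∀ K ∈ S.between F G, H ⊆ K → c H = c K := by
    intro H hH K hK h
    rcases h.eq_or_ssubset with h | h
    · rw [h]
    · exact hc H hH K hK h
  intro H hH K hK
  obtain ⟨p, hp, hpH⟩ := S.exists_cover_subset hF hH
  obtain ⟨q, hq, hqK⟩ := S.exists_cover_subset hF hK
  have hp' := S.mem_between_of_mem_covers hd0 hp
  have hq' := S.mem_between_of_mem_covers hd0 hq
  rw [← hc' p hp' H hH hpH, ← hc' q hq' K hK hqK]
  by_cases hpq : p = q
  · rw [hpq]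
  · obtain ⟨l, ⟨l1, -, l3, l4⟩, -⟩ := S.existsUnique_line hF hG hFG hd hp hq hpq
    rw [hc p hp' l l1 l3, hc q hq' l l1 l4]

/-- The function `t` lies above its affine interpolations in the cardinality on all intervals. -/
def IsStrictlyConcave (t : Finset α → ℝ) : Prop :=
  ∀ F ∈ S.flats, ∀ G ∈ S.flats, F ⊂ G → ∀ H ∈ S.between F G, 0 < normalizeAt F G t H

theorem eval_vol_pos {t : Finset α → ℝ} (ht : S.IsStrictlyConcave t) :
    ∀ F ∈ S.flats, ∀ G ∈ S.flats, F ⊂ G → 0 < eval t (S.vol F G) := by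
  refine S.interval_induction fun F hF G hG hFG ih => ?_
  by_cases hd : S.deg F G = 0
  · rw [S.vol_of_deg_eq_zero hd]; simp
  · rw [S.vol_of_deg_ne_zero hd, map_mul, MvPolynomial.eval_C, map_sum]
    refine mul_pos (inv_pos.2 (Nat.cast_pos.2 (Nat.pos_of_ne_zero hd))) (Finset.sum_pos ?_
      (S.between_nonempty hF hG hFG hd))
    intro H hH
    rw [map_mul, map_mul, eval_normX]
    exact mul_pos (ht F hF G hG hFG H hH) (mul_pos (ih H hH).1 (ih H hH).2)

end FlatSystem

section Incidence

theorem sum_incidence_eq {ι : Type*} [DecidableEq ι] (P L : Finset ι) (e : ι → ι → ℝ) (k : ι → ℝ)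
    (he : ∀ p ∈ P, ∀ q ∈ P, ∑ l ∈ L, e p l * e q l = if p = q then k p else 1) (y z : ι → ℝ) :
    ∑ p ∈ P, y p * (∑ l ∈ L, e p l * z l - (k p - 1) * z p) +
        ∑ l ∈ L, y l * (∑ p ∈ P, e p l * z p - z l) =
      (∑ p ∈ P, y p) * (∑ p ∈ P, z p) -
        ∑ l ∈ L, (y l - ∑ p ∈ P, e p l * y p) * (z l - ∑ p ∈ P, e p l * z p) := by
  have h1 : ∑ l ∈ L, (∑ p ∈ P, e p l * y p) * (∑ p ∈ P, e p l * z p) =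
      ∑ p ∈ P, ((k p - 1) * (y p * z p)) + (∑ p ∈ P, y p) * (∑ p ∈ P, z p) := by
    calc _ = ∑ p ∈ P, ∑ q ∈ P, y p * z q * ∑ l ∈ L, e p l * e q l := by
          simp_rw [Finset.sum_mul_sum, Finset.mul_sum]
          rw [Finset.sum_comm]
          refine Finset.sum_congr rfl fun p _ => ?_
          rw [Finset.sum_comm]
          exact Finset.sum_congr rfl fun q _ => Finset.sum_congr rfl fun l _ => by ring
      _ = ∑ p ∈ P, ∑ q ∈ P, ((if p = q then (k p - 1) * (y p * z q) else 0) + y p * z q) := by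
          refine Finset.sum_congr rfl fun p hp => Finset.sum_congr rfl fun q hq => ?_
          rw [he p hp q hq]
          split_ifs <;> ring
      _ = _ := by
          simp_rw [Finset.sum_add_distrib, ← Finset.sum_mul_sum]
          congr 1
          refine Finset.sum_congr rfl fun p hp => ?_
          simp [hp]
  have h2 : ∑ p ∈ P, y p * ∑ l ∈ L, e p l * z l = ∑ l ∈ L, (∑ p ∈ P, e p l * y p) * z l := by
    simp_rw [Finset.mul_sum, Finset.sum_mul]
    rw [Finset.sum_comm]
    exact Finset.sum_congr rfl fun l _ => Finset.sum_congr rfl fun p _ => by ring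
  have h3 : ∑ p ∈ P, y p * (∑ l ∈ L, e p l * z l - (k p - 1) * z p) =
      ∑ p ∈ P, y p * ∑ l ∈ L, e p l * z l - ∑ p ∈ P, ((k p - 1) * (y p * z p)) := by
    rw [← Finset.sum_sub_distrib]
    exact Finset.sum_congr rfl fun p _ => by ring
  have h4 : ∑ l ∈ L, (y l - ∑ p ∈ P, e p l * y p) * (z l - ∑ p ∈ P, e p l * z p) =
      ∑ l ∈ L, y l * z l - ∑ l ∈ L, y l * ∑ p ∈ P, e p l * z p -
        ∑ l ∈ L, (∑ p ∈ P, e p l * y p) * z l +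
        ∑ l ∈ L, (∑ p ∈ P, e p l * y p) * (∑ p ∈ P, e p l * z p) := by
    simp_rw [← Finset.sum_sub_distrib, ← Finset.sum_add_distrib]
    exact Finset.sum_congr rfl fun p _ => by ring
  have h5 : ∑ l ∈ L, y l * (∑ p ∈ P, e p l * z p - z l) =
      ∑ l ∈ L, y l * ∑ p ∈ P, e p l * z p - ∑ l ∈ L, y l * z l := by
    rw [← Finset.sum_sub_distrib]
    exact Finset.sum_congr rfl fun p _ => by ring
  rw [h3, h4, h5, h1, h2]
  ring

end Incidence

namespace FlatSystem

variable {α : Type*}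

theorem normalizeAt_left {F G : Finset α} (hFG : F ⊂ G) (y : Finset α → ℝ) :
    normalizeAt F G y F = 0 := by
  have h : (G.card : ℝ) - F.card ≠ 0 := by
    have : (F.card : ℝ) < G.card := by exact_mod_cast Finset.card_lt_card hFG
    linarith
  simp [normalizeAt, interpWeight, div_self h]

theorem normalizeAt_right (F G : Finset α) (y : Finset α → ℝ) : normalizeAt F G y G = 0 := by
  simp [normalizeAt, interpWeight]

theorem normalizeAt_of_eq_zero {F G : Finset α} {y : Finset α → ℝ} (hF : y F = 0) (hG : y G = 0)
    (H : Finset α) : normalizeAt F G y H = y H := by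
  simp [normalizeAt, hF, hG]

variable [DecidableEq α] (S : FlatSystem α)

section Fintype

variable [Fintype α]

variable {S} in
theorem IsIntervalPoly.dirDeriv_normalizeAt {F G : Finset α} {U : MvPolynomial (Finset α) ℝ}
    (hU : S.IsIntervalPoly F G U) (hFG : F ⊂ G) (y : Finset α → ℝ) :
    dirDeriv (normalizeAt F G y) U = dirDeriv y U := by
  rw [hU.dirDeriv_eq hFG, hU.dirDeriv_eq hFG]
  refine Finset.sum_congr rfl fun H _ => ?_
  rw [normalizeAt_of_eq_zero (normalizeAt_left hFG y) (normalizeAt_right F G y)]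

theorem dirDeriv_dirDeriv_vol {F G : Finset α} (hF : F ∈ S.flats) (hG : G ∈ S.flats)
    (hFG : F ⊂ G) (y z : Finset α → ℝ) :
    dirDeriv z (dirDeriv y (S.vol F G)) =
      ∑ H ∈ S.between F G, MvPolynomial.C (normalizeAt F G y H) * dirDeriv z (S.prodVol F G H) := by
  rw [S.dirDeriv_vol hF hG hFG, map_sum]
  exact Finset.sum_congr rfl fun H _ => by rw [dirDeriv_mul, dirDeriv_C, zero_mul, zero_add]

theorem dirDeriv_dirDeriv_vol_normalizeAt {F G : Finset α} (hF : F ∈ S.flats) (hG : G ∈ S.flats)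
    (hFG : F ⊂ G) (y z : Finset α → ℝ) :
    dirDeriv (normalizeAt F G z) (dirDeriv (normalizeAt F G y) (S.vol F G)) =
      dirDeriv z (dirDeriv y (S.vol F G)) := by
  rw [(S.isIntervalPoly_vol hF hG hFG).dirDeriv_normalizeAt hFG,
    S.dirDeriv_dirDeriv_vol hF hG hFG, S.dirDeriv_dirDeriv_vol hF hG hFG]
  refine Finset.sum_congr rfl fun H hH => ?_
  rw [(S.isIntervalPoly_prodVol hF hG hH).dirDeriv_normalizeAt hFG]

theorem dirDeriv_vol_of_deg_eq_one {F G : Finset α} (hF : F ∈ S.flats) (hG : G ∈ S.flats)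
    (hFG : F ⊂ G) (hd : S.deg F G = 1) (y : Finset α → ℝ) :
    dirDeriv y (S.vol F G) = ∑ H ∈ S.between F G, MvPolynomial.C (normalizeAt F G y H) := by
  rw [S.dirDeriv_vol hF hG hFG]
  refine Finset.sum_congr rfl fun H hH => ?_
  have := deg_add hF hG hH
  rw [prodVol, S.vol_of_deg_eq_zero (by omega), S.vol_of_deg_eq_zero (by omega), mul_one, mul_one]

end Fintype

theorem between_eq_covers {F G : Finset α} (hF : F ∈ S.flats) (hG : G ∈ S.flats)
    (hd : S.deg F G = 1) : S.between F G = S.covers F G := by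
  ext H
  refine ⟨fun h => ?_, S.mem_between_of_mem_covers (by omega)⟩
  have h' := deg_add hF hG h
  obtain ⟨h1, h2, h3⟩ := mem_between.1 h
  have r1 := S.rk_lt F hF H h1 h2
  simp only [deg] at h' hd
  refine mem_covers.2 ⟨h1, h2, h3.subset, ?_⟩
  have r2 := S.rk_lt H h1 G hG h3
  omega

theorem sum_interpWeight {F G : Finset α} (hF : F ∈ S.flats) (hG : G ∈ S.flats) (hFG : F ⊂ G)
    (hd : S.deg F G = 1) : ∑ H ∈ S.between F G, (1 - interpWeight F G H) = 1 := by
  have h : (G.card : ℝ) - F.card ≠ 0 := by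
    have : (F.card : ℝ) < G.card := by exact_mod_cast Finset.card_lt_card hFG
    linarith
  have e : ∀ H : Finset α, 1 - interpWeight F G H =
      ((H.card : ℝ) - F.card) / (G.card - F.card) := by
    intro H
    rw [interpWeight]
    field_simp
    ring
  simp_rw [e]
  rw [← Finset.sum_div, S.between_eq_covers hF hG hd, S.sum_covers hF hG hFG, div_self h]


section Fintype

variable [Fintype α]

theorem dirDeriv_prodVol_left {F G p : Finset α} (hF : F ∈ S.flats) (hG : G ∈ S.flats)
    (hd : S.deg F G = 2) (hp : p ∈ S.between F G) (hr : S.rk p = S.rk F + 1)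
    {z : Finset α → ℝ} (hzG : z G = 0) :
    dirDeriv z (S.prodVol F G p) =
      MvPolynomial.C (∑ l ∈ S.between p G, z l - (((S.between p G).card : ℝ) - 1) * z p) := by
  obtain ⟨h1, h2, h3⟩ := mem_between.1 hp
  have h4 : S.deg F p = 0 := by simp only [deg]; omega
  have h5 : S.deg p G = 1 := by have := deg_add hF hG hp; omega
  rw [prodVol, S.vol_of_deg_eq_zero h4, one_mul, S.dirDeriv_vol_of_deg_eq_one h1 hG h3 h5,
    ← map_sum]
  congr 1
  have h6 := S.sum_interpWeight h1 hG h3 h5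
  rw [Finset.sum_sub_distrib, Finset.sum_const, nsmul_eq_mul, mul_one] at h6
  simp only [normalizeAt, hzG, mul_zero, sub_zero]
  rw [Finset.sum_sub_distrib, ← Finset.sum_mul]
  congr 2
  linarith

theorem dirDeriv_prodVol_right {F G l : Finset α} (hF : F ∈ S.flats) (hG : G ∈ S.flats)
    (hd : S.deg F G = 2) (hl : l ∈ S.between F G) (hr : S.rk l = S.rk F + 2)
    {z : Finset α → ℝ} (hzF : z F = 0) :
    dirDeriv z (S.prodVol F G l) = MvPolynomial.C (∑ p ∈ S.between F l, z p - z l) := by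
  obtain ⟨h1, h2, h3⟩ := mem_between.1 hl
  have h4 : S.deg F l = 1 := by simp only [deg]; omega
  have h5 : S.deg l G = 0 := by have := deg_add hF hG hl; omega
  rw [prodVol, S.vol_of_deg_eq_zero h5, mul_one, S.dirDeriv_vol_of_deg_eq_one hF h1 h2 h4,
    ← map_sum]
  congr 1
  have h6 := S.sum_interpWeight hF h1 h2 h4
  simp only [normalizeAt, hzF, mul_zero, sub_zero]
  rw [Finset.sum_sub_distrib, ← Finset.sum_mul, h6, one_mul]

/-- In degree two, the Hessian of the volume polynomial is a difference of squares in which only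
one square has a positive sign. -/
theorem exists_dirDeriv_dirDeriv_vol_eq {F G : Finset α} (hF : F ∈ S.flats) (hG : G ∈ S.flats)
    (hFG : F ⊂ G) (hd : S.deg F G = 2) :
    ∃ (L : Finset (Finset α)) (a : (Finset α → ℝ) → ℝ) (b : (Finset α → ℝ) → Finset α → ℝ),
      ∀ y z, dirDeriv z (dirDeriv y (S.vol F G)) =
        MvPolynomial.C (a y * a z - ∑ l ∈ L, b y l * b z l) := by
  set P := (S.between F G).filter fun H => S.rk H = S.rk F + 1 with hP
  set L := (S.between F G).filter fun H => S.rk H = S.rk F + 2 with hL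
  let e : Finset α → Finset α → ℝ := fun p l => if p ⊂ l then 1 else 0
  have hsplit : ∀ g : Finset α → MvPolynomial (Finset α) ℝ,
      ∑ H ∈ S.between F G, g H = ∑ H ∈ P, g H + ∑ H ∈ L, g H := by
    intro g
    rw [← Finset.sum_filter_add_sum_filter_not (S.between F G) (fun H => S.rk H = S.rk F + 1)]
    congr 2
    refine Finset.filter_congr fun H hH => ?_
    have h := deg_add hF hG hH
    obtain ⟨h1, h2, h3⟩ := mem_between.1 hH
    have r1 := S.rk_lt F hF H h1 h2
    have r2 := S.rk_lt H h1 G hG h3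
    simp only [deg] at h hd
    omega
  have hbP : ∀ p ∈ P, S.between p G = L.filter fun l => p ⊂ l := by
    intro p hp
    ext l
    obtain ⟨hp1, hp2⟩ := Finset.mem_filter.1 hp
    obtain ⟨p1, p2, p3⟩ := mem_between.1 hp1
    simp only [mem_between, Finset.mem_filter, hL]
    constructor
    · rintro ⟨l1, l2, l3⟩
      have r1 := S.rk_lt p p1 l l1 l2
      have r2 := S.rk_lt l l1 G hG l3
      simp only [deg] at hd
      exact ⟨⟨⟨l1, p2.trans l2, l3⟩, by omega⟩, l2⟩
    · rintro ⟨⟨⟨l1, l2, l3⟩, l4⟩, l5⟩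
      exact ⟨l1, l5, l3⟩
  have hbL : ∀ l ∈ L, S.between F l = P.filter fun p => p ⊂ l := by
    intro l hl
    ext p
    obtain ⟨hl1, hl2⟩ := Finset.mem_filter.1 hl
    obtain ⟨l1, l2, l3⟩ := mem_between.1 hl1
    simp only [mem_between, Finset.mem_filter, hP]
    constructor
    · rintro ⟨p1, p2, p3⟩
      have r1 := S.rk_lt F hF p p1 p2
      have r2 := S.rk_lt p p1 l l1 p3
      exact ⟨⟨⟨p1, p2, p3.trans l3⟩, by omega⟩, p3⟩
    · rintro ⟨⟨⟨p1, p2, p3⟩, p4⟩, p5⟩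
      exact ⟨p1, p2, p5⟩
  have hPc : ∀ p ∈ P, p ∈ S.covers F G := by
    intro p hp
    obtain ⟨hp1, hp2⟩ := Finset.mem_filter.1 hp
    obtain ⟨p1, p2, p3⟩ := mem_between.1 hp1
    exact mem_covers.2 ⟨p1, p2, p3.subset, hp2⟩
  have he : ∀ p ∈ P, ∀ q ∈ P, ∑ l ∈ L, e p l * e q l =
      if p = q then ((S.between p G).card : ℝ) else 1 := by
    intro p hp q hq
    have h1 : ∀ l, e p l * e q l = if p ⊂ l ∧ q ⊂ l then 1 else 0 := by
      intro l
      simp only [e]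
      by_cases h : p ⊂ l <;> by_cases h' : q ⊂ l <;> simp [h, h']
    simp_rw [h1]
    rw [Finset.sum_ite, Finset.sum_const_zero, add_zero, Finset.sum_const, nsmul_eq_mul, mul_one]
    split_ifs with hpq
    · subst hpq
      rw [hbP p hp]
      simp
    · obtain ⟨l, ⟨l1, l2, l3, l4⟩, hl⟩ :=
        S.existsUnique_line hF hG hFG hd.ge (hPc p hp) (hPc q hq) hpq
      have : L.filter (fun l => p ⊂ l ∧ q ⊂ l) = {l} := by
        ext m
        rw [Finset.mem_filter, hL, Finset.mem_filter, Finset.mem_singleton]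
        constructor
        · rintro ⟨⟨m1, m2⟩, m3, m4⟩
          exact hl m ⟨m1, m2, m3, m4⟩
        · rintro rfl
          exact ⟨⟨l1, l2⟩, l3, l4⟩
      rw [this, Finset.card_singleton, Nat.cast_one]
  refine ⟨L, fun y => ∑ p ∈ P, normalizeAt F G y p,
    fun y l => normalizeAt F G y l - ∑ p ∈ P, e p l * normalizeAt F G y p, fun y z => ?_⟩
  rw [← S.dirDeriv_dirDeriv_vol_normalizeAt hF hG hFG y z]
  have hy1 := normalizeAt_left hFG y
  have hy2 := normalizeAt_right F G y
  have hz1 := normalizeAt_left hFG z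
  have hz2 := normalizeAt_right F G z
  set y' := normalizeAt F G y
  set z' := normalizeAt F G z
  have hsum := sum_incidence_eq P L e (fun p => ((S.between p G).card : ℝ)) he y' z'
  rw [S.dirDeriv_dirDeriv_vol hF hG hFG, hsplit, ← hsum, MvPolynomial.C_add,
    map_sum MvPolynomial.C, map_sum MvPolynomial.C]
  congr 1
  · refine Finset.sum_congr rfl fun p hp => ?_
    obtain ⟨hp1, hp2⟩ := Finset.mem_filter.1 hp
    rw [S.dirDeriv_prodVol_left hF hG hd hp1 hp2 hz2, normalizeAt_of_eq_zero hy1 hy2,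
      ← MvPolynomial.C_mul,
      hbP p hp, Finset.sum_filter]
    simp [e, ite_mul]
  · refine Finset.sum_congr rfl fun l hl => ?_
    obtain ⟨hl1, hl2⟩ := Finset.mem_filter.1 hl
    rw [S.dirDeriv_prodVol_right hF hG hd hl1 hl2 hz1, normalizeAt_of_eq_zero hy1 hy2,
      ← MvPolynomial.C_mul,
      hbL l hl, Finset.sum_filter]
    simp [e, ite_mul]

end Fintype

end FlatSystem

theorem MvPolynomial.RootConcaveAt.of_isHomogeneous {σ : Type*} [Fintype σ] {t : σ → ℝ} {n : ℕ}
    {p : MvPolynomial σ ℝ} (hp : p.IsHomogeneous n) (hn : 2 ≤ n)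
    (h : ∀ y, eval t (dirDeriv t (dirDeriv t p)) * eval t (dirDeriv y (dirDeriv y p)) ≤
      eval t (dirDeriv t (dirDeriv y p)) ^ 2) : RootConcaveAt t n p := by
  intro y
  have h1 := h y
  rw [(hp.dirDeriv t).eval_dirDeriv_self, (hp.dirDeriv y).eval_dirDeriv_self,
    hp.eval_dirDeriv_self, Nat.cast_sub (by omega), Nat.cast_one] at h1
  have h2 : (0 : ℝ) < n - 1 := by
    have : (2 : ℝ) ≤ n := by exact_mod_cast hn
    linarith
  refine le_of_mul_le_mul_left ?_ h2
  linarith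

namespace FlatSystem

variable {α : Type*} [DecidableEq α] (S : FlatSystem α)

theorem pderiv_prodVol_of_incomparable {F G H K : Finset α} (hF : F ∈ S.flats) (hG : G ∈ S.flats)
    (hH : H ∈ S.between F G) (hK : K ∈ S.between F G) (hHK : ¬ H ⊆ K) (hKH : ¬ K ⊆ H) :
    pderiv K (S.prodVol F G H) = 0 := by
  obtain ⟨h1, h2, h3⟩ := mem_between.1 hH
  obtain ⟨k1, k2, k3⟩ := mem_between.1 hK
  have hne : K ≠ H := fun h => hKH h.subset
  rw [prodVol, pderiv_mul, S.pderiv_vol_eq_zero F hF H h1 h2 K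
    (fun h => hKH (mem_between.1 h).2.2.subset) k2.ne' hne,
    S.pderiv_vol_eq_zero H h1 G hG h3 K (fun h => hHK (mem_between.1 h).2.1.subset) hne k3.ne,
    zero_mul, mul_zero, add_zero]

variable [Fintype α]

theorem pderiv_prodVol_of_ssubset {F G H K : Finset α} (hF : F ∈ S.flats) (hG : G ∈ S.flats)
    (hH : H ∈ S.between F G) (hK : K ∈ S.between F G) (hHK : H ⊂ K) :
    pderiv K (S.prodVol F G H) = S.vol F H * S.prodVol H G K := by
  obtain ⟨h1, h2, h3⟩ := mem_between.1 hH
  obtain ⟨k1, k2, k3⟩ := mem_between.1 hK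
  rw [prodVol, pderiv_mul, S.pderiv_vol_eq_zero F hF H h1 h2 K
    (fun h => hHK.2 (mem_between.1 h).2.2.subset) k2.ne' hHK.ne', zero_mul, zero_add,
    S.pderiv_vol H h1 G hG h3 K (mem_between.2 ⟨k1, hHK, k3⟩)]

theorem pderiv_prodVol_comm {F G H K : Finset α} (hF : F ∈ S.flats) (hG : G ∈ S.flats)
    (hFG : F ⊂ G) (hH : H ∈ S.between F G) (hK : K ∈ S.between F G) :
    pderiv K (S.prodVol F G H) = pderiv H (S.prodVol F G K) := by
  rw [← S.pderiv_vol F hF G hG hFG H hH, ← S.pderiv_vol F hF G hG hFG K hK, pderiv_pderiv_comm]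

/-- The volume polynomial of an interval is log-concave at strictly concave functions. -/
theorem rootConcaveAt_vol {t : Finset α → ℝ} (ht : S.IsStrictlyConcave t) :
    ∀ F ∈ S.flats, ∀ G ∈ S.flats, F ⊂ G → RootConcaveAt t (S.deg F G) (S.vol F G) := by
  refine S.interval_induction fun F hF G hG hFG ih => ?_
  have hhom := S.isHomogeneous_vol F hF G hG hFG
  have hpos := S.eval_vol_pos ht
  rcases Nat.lt_or_ge (S.deg F G) 2 with hd | hd
  · intro y
    have h1 : dirDeriv y (dirDeriv y (S.vol F G)) = 0 := by
      have h2 := hhom.dirDeriv y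
      rw [show S.deg F G - 1 = 0 by omega] at h2
      rw [totalDegree_eq_zero_iff_eq_C.1 (Nat.le_zero.1 h2.totalDegree_le), dirDeriv_C]
    rw [h1, map_zero, mul_zero]
    interval_cases h : S.deg F G
    · rw [S.vol_of_deg_eq_zero h, ← MvPolynomial.C_1, dirDeriv_C, map_zero]
      norm_num
    · norm_num
  refine .of_isHomogeneous hhom hd fun y => ?_
  rcases hd.eq_or_lt with hd2 | hd3
  · obtain ⟨L, a, b, hab⟩ := S.exists_dirDeriv_dirDeriv_vol_eq hF hG hFG hd2.symm
    have hV : 0 < eval t (dirDeriv t (dirDeriv t (S.vol F G))) := by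
      rw [(hhom.dirDeriv t).eval_dirDeriv_self, hhom.eval_dirDeriv_self, ← hd2]
      have := hpos F hF G hG hFG
      norm_num
      exact this
    rw [dirDeriv_comm t y]
    simp only [hab, MvPolynomial.eval_C] at hV ⊢
    exact reversed_cauchy_schwarz_sub_sum L _ _ _ _ hV
  let ι := {H // H ∈ S.between F G}
  let M : Matrix ι ι ℝ := fun H K => eval t (pderiv K.1 (S.prodVol F G H.1))
  let r : (Finset α → ℝ) → ι → ℝ := fun w H => normalizeAt F G w H.1
  have hMr : ∀ w (H : ι), M.mulVec (r w) H = eval t (dirDeriv w (S.prodVol F G H.1)) := by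
    intro w H
    rw [(S.isIntervalPoly_prodVol hF hG H.2).dirDeriv_eq hFG, map_sum, ← Finset.sum_coe_sort]
    exact Finset.sum_congr rfl fun K _ => by
      rw [map_mul, MvPolynomial.eval_C, mul_comm]
  have hrMr : ∀ w z, dotProduct (r w) (M.mulVec (r z)) =
      eval t (dirDeriv z (dirDeriv w (S.vol F G))) := by
    intro w z
    rw [S.dirDeriv_dirDeriv_vol hF hG hFG, map_sum, ← Finset.sum_coe_sort]
    exact Finset.sum_congr rfl fun K _ => by rw [hMr, map_mul, MvPolynomial.eval_C]
  have hsurj : ∀ z : ι → ℝ, ∃ w, r w = z := by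
    intro z
    refine ⟨fun H => if h : H ∈ S.between F G then z ⟨H, h⟩ else 0, ?_⟩
    funext H
    have h1 : F ∉ S.between F G := fun h => (mem_between.1 h).2.1.ne rfl
    have h2 : G ∉ S.between F G := fun h => (mem_between.1 h).2.2.ne rfl
    simp only [r]
    rw [normalizeAt_of_eq_zero (by simp [h1]) (by simp [h2]), dif_pos H.2]
  have hUpos : ∀ H ∈ S.between F G, 0 < eval t (S.prodVol F G H) := by
    intro H hH
    obtain ⟨h1, h2, h3⟩ := mem_between.1 hH
    rw [prodVol, map_mul]
    exact mul_pos (hpos F hF H h1 h2) (hpos H h1 G hG h3)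
  have hU : ∀ H ∈ S.between F G, RootConcaveAt t (S.deg F G - 1) (S.prodVol F G H) := by
    intro H hH
    rw [show S.deg F G - 1 = S.deg F H + S.deg H G by have := deg_add hF hG hH; omega]
    exact (ih H hH).1.mul (ih H hH).2 S.vol_of_deg_eq_zero S.vol_of_deg_eq_zero
  have hMlt : ∀ H K : ι, H.1 ⊂ K.1 → 0 < M H K := by
    intro H K h
    obtain ⟨h1, h2, h3⟩ := mem_between.1 H.2
    obtain ⟨k1, k2, k3⟩ := mem_between.1 K.2
    simp only [M]
    rw [S.pderiv_prodVol_of_ssubset hF hG H.2 K.2 h, prodVol, map_mul, map_mul]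
    exact mul_pos (hpos _ hF _ h1 h2) (mul_pos (hpos _ h1 _ k1 h) (hpos _ k1 _ hG k3))
  have hsymm : ∀ H K, M H K = M K H := fun H K => by
    simp only [M]
    rw [S.pderiv_prodVol_comm hF hG hFG H.2 K.2]
  have hdcast : ((S.deg F G - 1 : ℕ) : ℝ) = S.deg F G - 1 := by
    rw [Nat.cast_sub (by omega), Nat.cast_one]
  have hd3' : (3 : ℝ) ≤ S.deg F G := by exact_mod_cast hd3
  have hMt : ∀ H, M.mulVec (r t) H = (S.deg F G - 1) * eval t (S.prodVol F G H.1) := by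
    intro H
    rw [hMr, (S.isHomogeneous_prodVol hF hG H.2).eval_dirDeriv_self, hdcast]
  have hMtpos : ∀ H, 0 < M.mulVec (r t) H := by
    intro H
    rw [hMt]
    exact mul_pos (by linarith) (hUpos H.1 H.2)
  have hrt : ∀ H, 0 < r t H := fun H => ht F hF G hG hFG H.1 H.2
  have key := Matrix.IsSymm.reversed_cauchy_schwarz_of_bochner (M := M)
    (Matrix.IsSymm.ext fun H K => hsymm K H) ?_ ?_ (r t) hrt hMtpos ?_ (r y)
  · rwa [hrMr, hrMr, hrMr, dirDeriv_comm y t] at key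
  · intro H K hne
    have hne' : H.1 ≠ K.1 := fun h => hne (Subtype.ext h)
    by_cases h1 : H.1 ⊆ K.1
    · exact (hMlt H K (Finset.ssubset_iff_subset_ne.2 ⟨h1, hne'⟩)).le
    by_cases h2 : K.1 ⊆ H.1
    · rw [hsymm]
      exact (hMlt K H (Finset.ssubset_iff_subset_ne.2 ⟨h2, hne'.symm⟩)).le
    simp only [M]
    rw [S.pderiv_prodVol_of_incomparable hF hG H.2 K.2 h1 h2, map_zero]
  · intro c hc
    have := S.between_connected hF hG hFG hd
      (fun H => if h : H ∈ S.between F G then c ⟨H, h⟩ else 0) (by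
        intro H hH K hK hHK
        rw [dif_pos hH, dif_pos hK]
        exact hc _ _ (fun h => hHK.ne (congrArg Subtype.val h)) (hMlt _ _ hHK))
    intro H K
    have h := this H.1 H.2 K.1 K.2
    rwa [dif_pos H.2, dif_pos K.2] at h
  · intro z
    obtain ⟨w, rfl⟩ := hsurj z
    have h1 : ((S.deg F G : ℝ) - 2) * eval t (dirDeriv w (dirDeriv w (S.vol F G))) =
        ∑ H : ι, r t H * eval t (dirDeriv w (dirDeriv w (S.prodVol F G H.1))) := by
      have h2 := ((hhom.dirDeriv w).dirDeriv w).eval_dirDeriv_self t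
      rw [show S.deg F G - 1 - 1 = S.deg F G - 2 by omega, Nat.cast_sub hd, Nat.cast_ofNat] at h2
      rw [← h2, dirDeriv_comm t w, dirDeriv_comm t w, S.dirDeriv_vol hF hG hFG, map_sum, map_sum,
        map_sum, ← Finset.sum_coe_sort]
      refine Finset.sum_congr rfl fun H _ => ?_
      rw [dirDeriv_mul, dirDeriv_C, zero_mul, zero_add, dirDeriv_mul, dirDeriv_C, zero_mul,
        zero_add, map_mul, MvPolynomial.eval_C]
    have hd2 : (0 : ℝ) < S.deg F G - 2 := by linarith
    rw [hrMr]
    refine le_of_mul_le_mul_left ?_ hd2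
    rw [h1, Finset.mul_sum]
    refine Finset.sum_le_sum fun H _ => ?_
    rw [hMt, hMr]
    have h3 := hU H.1 H.2 w
    rw [hdcast] at h3
    have h4 : 0 < ((S.deg F G : ℝ) - 1) * eval t (S.prodVol F G H.1) :=
      mul_pos (by linarith) (hUpos H.1 H.2)
    rw [← mul_div_assoc, le_div_iff₀ h4]
    have h5 := mul_le_mul_of_nonneg_left h3 (hrt H).le
    linarith

end FlatSystem

namespace FlatSystem

variable {α : Type*}

theorem normalizeAt_add_smul (F G : Finset α) (y z : Finset α → ℝ) (c : ℝ) (H : Finset α) :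
    normalizeAt F G (fun K => y K + c * z K) H =
      normalizeAt F G y H + c * normalizeAt F G z H := by
  simp only [normalizeAt]
  ring

variable [DecidableEq α]

/-- Minus the indicator function of a set. -/
def negIndicator (A H : Finset α) : ℝ := if H = A then -1 else 0

theorem normalizeAt_negIndicator_bot {G H : Finset α} (hH : ∅ ⊂ H) (hG : H ⊂ G) :
    normalizeAt ∅ G (negIndicator ∅) H = interpWeight ∅ G H := by
  simp [normalizeAt, negIndicator, hH.ne', (hH.trans hG).ne']

theorem normalizeAt_negIndicator_of_ne {A F G H : Finset α} (hF : F ≠ A) (hH : H ≠ A)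
    (hG : G ≠ A) : normalizeAt F G (negIndicator A) H = 0 := by
  simp [normalizeAt, negIndicator, hF, hH, hG]

theorem normalizeAt_negIndicator_top {F G H : Finset α} (hF : F ⊂ H) (hH : H ⊂ G) :
    normalizeAt F G (negIndicator G) H = 1 - interpWeight F G H := by
  simp [normalizeAt, negIndicator, hH.ne, (hF.trans hH).ne]

variable (S : FlatSystem α)

theorem isStrictlyConcave_negIndicator_bot {c : ℝ} (hc : 0 < c) :
    S.IsStrictlyConcave fun H => negIndicator ∅ H + c * -((H.card : ℝ) ^ 2) := by
  intro F hF G hG hFG H hH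
  obtain ⟨-, h1, h2⟩ := mem_between.1 hH
  have r1 : (F.card : ℝ) < H.card := by exact_mod_cast Finset.card_lt_card h1
  have r2 : (H.card : ℝ) < G.card := by exact_mod_cast Finset.card_lt_card h2
  have hne : (G.card : ℝ) - F.card ≠ 0 := by linarith
  rw [normalizeAt_add_smul]
  have e1 : normalizeAt F G (fun H => -((H.card : ℝ) ^ 2)) H =
      ((H.card : ℝ) - F.card) * (G.card - H.card) := by
    simp only [normalizeAt, interpWeight]
    field_simp
    ring
  have e2 : 0 ≤ normalizeAt F G (negIndicator ∅) H := by
    have hH0 : ∅ ⊂ H := (Finset.empty_subset F).trans_ssubset h1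
    by_cases hF0 : F = ∅
    · subst hF0
      rw [normalizeAt_negIndicator_bot hH0 h2, interpWeight]
      exact div_nonneg (by linarith) (by linarith)
    · rw [normalizeAt_negIndicator_of_ne hF0 hH0.ne' (hH0.trans h2).ne']
  rw [e1]
  have := mul_pos hc (mul_pos (sub_pos.2 r1) (sub_pos.2 r2))
  linarith

theorem eval_vol_negIndicator_bot {F G : Finset α} (hF : F ≠ ∅) (hd : S.deg F G ≠ 0) :
    eval (negIndicator ∅) (S.vol F G) = 0 := by
  rw [S.vol_of_deg_ne_zero hd, map_mul, map_sum,
      Finset.sum_eq_zero, mul_zero]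
  intro H hH
  obtain ⟨-, h1, h2⟩ := mem_between.1 hH
  have hH0 : ∅ ⊂ H := (Finset.empty_subset F).trans_ssubset h1
  rw [map_mul, eval_normX, normalizeAt_negIndicator_of_ne hF hH0.ne' (hH0.trans h2).ne', zero_mul]

theorem deg_mul_eval_vol_bot {G : Finset α} (hd : S.deg ∅ G ≠ 0) :
    S.deg ∅ G * eval (negIndicator ∅) (S.vol ∅ G) =
      ∑ H ∈ S.between ∅ G with S.deg H G = 0,
        interpWeight ∅ G H * eval (negIndicator ∅) (S.vol ∅ H) := by
  have h := congrArg (MvPolynomial.eval (negIndicator ∅)) (S.deg_smul_vol hd)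
  rw [MvPolynomial.smul_eval] at h
  rw [h, map_sum, Finset.sum_filter]
  refine Finset.sum_congr rfl fun H hH => ?_
  obtain ⟨-, h1, h2⟩ := mem_between.1 hH
  rw [map_mul, map_mul, eval_normX, normalizeAt_negIndicator_bot h1 h2]
  split_ifs with h0
  · rw [S.vol_of_deg_eq_zero h0, map_one, mul_one]
  · rw [S.eval_vol_negIndicator_bot h1.ne' h0, mul_zero, mul_zero]

variable [Fintype α]

theorem eval_dirDeriv_vol_bot {G : Finset α} (hbot : ∅ ∈ S.flats) (hG : G ∈ S.flats)
    (hG0 : ∅ ⊂ G) : eval (negIndicator ∅) (dirDeriv (negIndicator G) (S.vol ∅ G)) =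
      ∑ H ∈ S.between ∅ G with S.deg H G = 0,
        (1 - interpWeight ∅ G H) * eval (negIndicator ∅) (S.vol ∅ H) := by
  rw [S.dirDeriv_vol hbot hG hG0, map_sum, Finset.sum_filter]
  refine Finset.sum_congr rfl fun H hH => ?_
  obtain ⟨-, h1, h2⟩ := mem_between.1 hH
  rw [map_mul, prodVol, map_mul, MvPolynomial.eval_C, normalizeAt_negIndicator_top h1 h2]
  split_ifs with h0
  · rw [S.vol_of_deg_eq_zero h0, map_one, mul_one]
  · rw [S.eval_vol_negIndicator_bot h1.ne' h0, mul_zero, mul_zero]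

theorem eval_dirDeriv_vol_top {F G : Finset α} (hF : F ∈ S.flats) (hG : G ∈ S.flats)
    (hF0 : F ≠ ∅) (hFG : F ⊂ G) :
    eval (negIndicator ∅) (dirDeriv (negIndicator G) (S.vol F G)) =
      if S.deg F G = 1 then 1 else 0 := by
  split_ifs with hd
  · rw [S.dirDeriv_vol_of_deg_eq_one hF hG hFG hd, map_sum, ← S.sum_interpWeight hF hG hFG hd]
    refine Finset.sum_congr rfl fun H hH => ?_
    obtain ⟨-, h1, h2⟩ := mem_between.1 hH
    rw [MvPolynomial.eval_C, normalizeAt_negIndicator_top h1 h2]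
  · rw [S.dirDeriv_vol hF hG hFG, map_sum, Finset.sum_eq_zero]
    intro H hH
    have hdeg := deg_add hF hG hH
    obtain ⟨-, h1, h2⟩ := mem_between.1 hH
    have hH0 : H ≠ ∅ := ((Finset.empty_subset F).trans_ssubset h1).ne'
    rw [map_mul, prodVol, map_mul]
    by_cases h3 : S.deg F H = 0
    · rw [S.eval_vol_negIndicator_bot hH0 (by omega), mul_zero, mul_zero]
    · rw [S.eval_vol_negIndicator_bot hF0 h3, zero_mul, mul_zero]

theorem eval_dirDeriv_dirDeriv_vol_bot {G : Finset α} (hbot : ∅ ∈ S.flats) (hG : G ∈ S.flats)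
    (hG0 : ∅ ⊂ G) :
    eval (negIndicator ∅) (dirDeriv (negIndicator G) (dirDeriv (negIndicator G) (S.vol ∅ G))) =
      ∑ H ∈ S.between ∅ G with S.deg H G = 1,
        (1 - interpWeight ∅ G H) * eval (negIndicator ∅) (S.vol ∅ H) := by
  rw [S.dirDeriv_dirDeriv_vol hbot hG hG0, map_sum, Finset.sum_filter]
  refine Finset.sum_congr rfl fun H hH => ?_
  obtain ⟨hH', h1, h2⟩ := mem_between.1 hH
  have h3 : dirDeriv (negIndicator G) (S.vol ∅ H) = 0 := by
    rw [S.dirDeriv_vol hbot hH' h1, Finset.sum_eq_zero]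
    intro K hK
    obtain ⟨-, k1, k2⟩ := mem_between.1 hK
    rw [normalizeAt_negIndicator_of_ne hG0.ne (k2.trans h2).ne h2.ne, MvPolynomial.C_0, zero_mul]
  rw [map_mul, prodVol, dirDeriv_mul, h3, zero_mul, zero_add, map_mul, MvPolynomial.eval_C,
    normalizeAt_negIndicator_top h1 h2, S.eval_dirDeriv_vol_top hH' hG h1.ne' h2]
  split_ifs <;> simp

theorem rootConcaveAt_vol_bot {G : Finset α} (hbot : ∅ ∈ S.flats) (hG : G ∈ S.flats)
    (hG0 : ∅ ⊂ G) : RootConcaveAt (negIndicator ∅) (S.deg ∅ G) (S.vol ∅ G) := by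
  intro y
  let t : ℝ → Finset α → ℝ := fun c H => negIndicator ∅ H + c * -((H.card : ℝ) ^ 2)
  have ht : Continuous t := by
    refine continuous_pi fun H => ?_
    simp only [t]
    fun_prop
  have hev : ∀ p : MvPolynomial (Finset α) ℝ, Continuous fun c => eval (t c) p := fun p =>
    (MvPolynomial.continuous_eval p).comp ht
  have h0 : t 0 = negIndicator ∅ := by
    funext H
    simp [t]
  have key := le_on_closure (s := Set.Ioi (0 : ℝ)) (x := 0)
    (fun c hc => S.rootConcaveAt_vol (S.isStrictlyConcave_negIndicator_bot hc) ∅ hbot G hG hG0 y)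
    ((continuous_const.mul (hev _)).mul (hev _)).continuousOn
    (continuous_const.mul ((hev _).pow 2)).continuousOn (by simp)
  change _ * MvPolynomial.eval (t 0) _ * MvPolynomial.eval (t 0) _ ≤
    _ * MvPolynomial.eval (t 0) _ ^ 2 at key
  rwa [h0] at key

/-- The log-concavity inequality at the top of a flat system, for a function satisfying the
recursion of the Möbius function. -/
theorem sum_mul_sum_le_sq_of_recursion (hbot : ∅ ∈ S.flats) (hr0 : S.rk ∅ = 0) {E : Finset α}
    (hE : E ∈ S.flats) (hrE : 3 ≤ S.rk E) (b : Finset α → ℝ) (hb0 : b ∅ = 1)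
    (hb : ∀ G ∈ S.flats, ∅ ⊂ G → G ⊂ E → (G.card : ℝ) * b G =
      ∑ H ∈ S.flats with H ⊂ G ∧ S.rk H + 1 = S.rk G, ((G.card : ℝ) - H.card) * b H) :
    (∑ H ∈ S.flats with H ⊂ E ∧ S.rk H + 2 = S.rk E, (H.card : ℝ) * b H) *
      (∑ H ∈ S.flats with H ⊂ E ∧ S.rk H + 1 = S.rk E, ((E.card : ℝ) - H.card) * b H) ≤
      (∑ H ∈ S.flats with H ⊂ E ∧ S.rk H + 1 = S.rk E, (H.card : ℝ) * b H) ^ 2 := by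
  have hE0 : ∅ ⊂ E := by
    rw [Finset.empty_ssubset, Finset.nonempty_iff_ne_empty]
    rintro rfl
    omega
  have hcard : ∀ G : Finset α, ∅ ⊂ G → (0 : ℝ) < G.card := fun G hG => by
    exact_mod_cast Finset.card_pos.2 (Finset.empty_ssubset.1 hG)
  have hw : ∀ G H : Finset α, ∅ ⊂ G → interpWeight ∅ G H = ((G.card : ℝ) - H.card) / G.card := by
    intro G H _
    simp [interpWeight]
  have hw' : ∀ G H : Finset α, ∅ ⊂ G → 1 - interpWeight ∅ G H = (H.card : ℝ) / G.card := by
    intro G H hG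
    have := hcard G hG
    rw [hw G H hG]
    field_simp
    ring
  have hfil : ∀ G ∈ S.flats, ∅ ⊂ G → ∀ k, k + 1 < S.rk G →
      (S.between ∅ G).filter (fun H => S.deg H G = k) =
        S.flats.filter fun H => H ⊂ G ∧ S.rk H + (k + 1) = S.rk G := by
    intro G hG hG0 k hk
    ext H
    rw [Finset.mem_filter, Finset.mem_filter, mem_between]
    simp only [deg]
    constructor
    · rintro ⟨⟨h1, h2, h3⟩, h4⟩
      have := S.rk_lt H h1 G hG h3
      exact ⟨h1, h3, by omega⟩
    · rintro ⟨h1, h2, h3⟩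
      refine ⟨⟨h1, ?_, h2⟩, by omega⟩
      rw [Finset.empty_ssubset, Finset.nonempty_iff_ne_empty]
      rintro rfl
      omega
  have hv : ∀ n, ∀ G ∈ S.flats, G ⊂ E → S.rk G = n + 1 →
      (n.factorial : ℝ) * eval (negIndicator ∅) (S.vol ∅ G) = b G := by
    intro n
    induction n with
    | zero =>
      intro G hG hGE hr
      have hG0 : ∅ ⊂ G := by
        rw [Finset.empty_ssubset, Finset.nonempty_iff_ne_empty]
        rintro rfl
        omega
      have h1 : S.flats.filter (fun H => H ⊂ G ∧ S.rk H + 1 = S.rk G) = {∅} := by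
        ext H
        rw [Finset.mem_filter, Finset.mem_singleton]
        constructor
        · rintro ⟨h1, h2, h3⟩
          by_contra h
          have := S.rk_lt ∅ hbot H h1 (Finset.empty_ssubset.2 (Finset.nonempty_iff_ne_empty.2 h))
          omega
        · rintro rfl
          exact ⟨hbot, hG0, by omega⟩
      have h2 := hb G hG hG0 hGE
      rw [h1, Finset.sum_singleton, hb0, mul_one, Finset.card_empty, Nat.cast_zero,
        sub_zero] at h2
      have h3 : S.deg ∅ G = 0 := by simp only [deg]; omega
      rw [S.vol_of_deg_eq_zero h3, map_one, Nat.factorial_zero, Nat.cast_one, mul_one]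
      exact (mul_eq_left₀ (hcard G hG0).ne').1 h2 |>.symm
    | succ n ih =>
      intro G hG hGE hr
      have hG0 : ∅ ⊂ G := by
        rw [Finset.empty_ssubset, Finset.nonempty_iff_ne_empty]
        rintro rfl
        omega
      have h3 : S.deg ∅ G = n + 1 := by simp only [deg]; omega
      have h4 := S.deg_mul_eval_vol_bot (G := G) (by omega)
      have hpos := hcard G hG0
      have h2 := hb G hG hG0 hGE
      rw [hfil G hG hG0 0 (by omega), h3] at h4
      refine mul_left_cancel₀ hpos.ne' ?_
      rw [h2, Nat.factorial_succ, Nat.cast_mul,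
        show (G.card : ℝ) * (((n + 1 : ℕ) : ℝ) * n.factorial *
          eval (negIndicator ∅) (S.vol ∅ G)) = G.card * n.factorial *
          (((n + 1 : ℕ) : ℝ) * eval (negIndicator ∅) (S.vol ∅ G)) by ring, h4, Finset.mul_sum]
      refine Finset.sum_congr rfl fun H hH => ?_
      obtain ⟨h5, h6, h7⟩ := Finset.mem_filter.1 hH
      rw [← ih H h5 (h6.trans hGE) (by omega), hw G H hG0]
      field_simp
  have hpos := hcard E hE0
  obtain ⟨n, hn⟩ : ∃ n, S.rk E = n + 3 := ⟨S.rk E - 3, by omega⟩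
  have hdE : S.deg ∅ E = n + 2 := by simp only [deg]; omega
  have key := S.rootConcaveAt_vol_bot hbot hE hE0 (negIndicator E)
  rw [S.deg_mul_eval_vol_bot (by omega), S.eval_dirDeriv_vol_bot hbot hE hE0,
    S.eval_dirDeriv_dirDeriv_vol_bot hbot hE hE0, hfil E hE hE0 0 (by omega),
    hfil E hE hE0 1 (by omega), hdE] at key
  have hf0 : (0 : ℝ) < n.factorial := by exact_mod_cast n.factorial_pos
  have hf1 : (0 : ℝ) < (n + 1).factorial := by exact_mod_cast (n + 1).factorial_pos
  have e1 : ∑ H ∈ S.flats with H ⊂ E ∧ S.rk H + (0 + 1) = S.rk E,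
      interpWeight ∅ E H * eval (negIndicator ∅) (S.vol ∅ H) =
      (∑ H ∈ S.flats with H ⊂ E ∧ S.rk H + 1 = S.rk E, ((E.card : ℝ) - H.card) * b H) /
        (E.card * (n + 1).factorial) := by
    rw [Finset.sum_div]
    refine Finset.sum_congr rfl fun H hH => ?_
    obtain ⟨h5, h6, h7⟩ := Finset.mem_filter.1 hH
    rw [← hv (n + 1) H h5 h6 (by omega), hw E H hE0]
    field_simp
  have e2 : ∑ H ∈ S.flats with H ⊂ E ∧ S.rk H + (0 + 1) = S.rk E,
      (1 - interpWeight ∅ E H) * eval (negIndicator ∅) (S.vol ∅ H) =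
      (∑ H ∈ S.flats with H ⊂ E ∧ S.rk H + 1 = S.rk E, (H.card : ℝ) * b H) /
        (E.card * (n + 1).factorial) := by
    rw [Finset.sum_div]
    refine Finset.sum_congr rfl fun H hH => ?_
    obtain ⟨h5, h6, h7⟩ := Finset.mem_filter.1 hH
    rw [← hv (n + 1) H h5 h6 (by omega), hw' E H hE0]
    field_simp
  have e3 : ∑ H ∈ S.flats with H ⊂ E ∧ S.rk H + (1 + 1) = S.rk E,
      (1 - interpWeight ∅ E H) * eval (negIndicator ∅) (S.vol ∅ H) =
      (∑ H ∈ S.flats with H ⊂ E ∧ S.rk H + 2 = S.rk E, (H.card : ℝ) * b H) /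
        (E.card * n.factorial) := by
    rw [Finset.sum_div]
    refine Finset.sum_congr rfl fun H hH => ?_
    obtain ⟨h5, h6, h7⟩ := Finset.mem_filter.1 hH
    rw [← hv n H h5 h6 (by omega), hw' E H hE0]
    field_simp
  rw [e1, e2, e3, div_mul_div_comm, div_pow, ← mul_div_assoc,
    div_le_div_iff₀ (by positivity) (by positivity)] at key
  rw [Nat.factorial_succ] at key
  push_cast at key
  have hc : (0 : ℝ) < (E.card : ℝ) ^ 2 * (n.factorial : ℝ) ^ 2 * ((n : ℝ) + 1) ^ 2 := by positivity
  refine le_of_mul_le_mul_left ?_ hc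
  linarith

end FlatSystem

end Volume

namespace FlatSystem

variable {α : Type*} [DecidableEq α] [Fintype α] (S : FlatSystem α)

/-- The truncation of a flat system: the flats of rank at least `m` are replaced by the ground
set. -/
def truncate (m : ℕ) (hE : Finset.univ ∈ S.flats) (hm : m ≤ S.rk Finset.univ) : FlatSystem α where
  flats := insert Finset.univ (S.flats.filter fun H => S.rk H < m)
  rk H := min (S.rk H) m
  rk_lt F hF G hG hFG := by
    have hFr : F ∈ S.flats ∧ S.rk F < m := by
      rcases Finset.mem_insert.1 hF with h | h
      · exact absurd (Finset.subset_univ G) (h ▸ hFG).2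
      · exact Finset.mem_filter.1 h
    have hGr : G ∈ S.flats := by
      rcases Finset.mem_insert.1 hG with h | h
      · exact h ▸ hE
      · exact (Finset.mem_filter.1 h).1
    have := S.rk_lt F hFr.1 G hGr hFG
    omega
  cover F hF G hG hFG a ha haF := by
    have hFr : F ∈ S.flats ∧ S.rk F < m := by
      rcases Finset.mem_insert.1 hF with h | h
      · exact absurd (Finset.subset_univ G) (h ▸ hFG).2
      · exact Finset.mem_filter.1 h
    have hGr : G ∈ S.flats := by
      rcases Finset.mem_insert.1 hG with h | h
      · exact h ▸ hE
      · exact (Finset.mem_filter.1 h).1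
    by_cases hlt : S.rk F + 1 < m
    · obtain ⟨H, ⟨h1, h2, h3, h4, h5⟩, hu⟩ := S.cover F hFr.1 G hGr hFG a ha haF
      refine ⟨H, ⟨Finset.mem_insert_of_mem (Finset.mem_filter.2 ⟨h1, by omega⟩), h2, h3, h4,
        by omega⟩, ?_⟩
      rintro K ⟨k1, k2, k3, k4, k5⟩
      have k1' : K ∈ S.flats := by
        rcases Finset.mem_insert.1 k1 with h | h
        · exact h ▸ hE
        · exact (Finset.mem_filter.1 h).1
      exact hu K ⟨k1', k2, k3, k4, by omega⟩
    · have hGE : G = Finset.univ := by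
        rcases Finset.mem_insert.1 hG with h | h
        · exact h
        · have h1 := (Finset.mem_filter.1 h).2
          have h2 := S.rk_lt F hFr.1 G hGr hFG
          omega
      refine ⟨Finset.univ, ⟨Finset.mem_insert_self _ _, Finset.subset_univ _, hGE.symm.subset,
        Finset.mem_univ a, by omega⟩, ?_⟩
      rintro K ⟨k1, k2, k3, k4, k5⟩
      rcases Finset.mem_insert.1 k1 with h | h
      · exact h
      · have := (Finset.mem_filter.1 h).2
        omega

/-- The recursion satisfied by the absolute values of the Möbius function of the lattice of flats
of a loopless matroid. -/
structure IsMobius (b : Finset α → ℝ) : Prop where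
  empty_mem : ∅ ∈ S.flats
  univ_mem : Finset.univ ∈ S.flats
  rk_empty : S.rk ∅ = 0
  map_empty : b ∅ = 1
  card_mul : ∀ G ∈ S.flats, G ≠ ∅ → (G.card : ℝ) * b G =
    ∑ H ∈ S.flats with H ⊂ G ∧ S.rk H + 1 = S.rk G, ((G.card : ℝ) - H.card) * b H

/-- The sum of `b` over the flats of rank `k`. -/
def whitney (b : Finset α → ℝ) (k : ℕ) : ℝ := ∑ H ∈ S.flats with S.rk H = k, b H

/-- The sum of `b` over the flats of rank `k`, weighted by cardinality. -/
def weightedWhitney (b : Finset α → ℝ) (k : ℕ) : ℝ :=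
  ∑ H ∈ S.flats with S.rk H = k, (H.card : ℝ) * b H

namespace IsMobius

variable {S} {b : Finset α → ℝ} (h : S.IsMobius b)

include h

theorem rk_le {F : Finset α} (hF : F ∈ S.flats) : S.rk F ≤ S.rk Finset.univ := by
  rcases (Finset.subset_univ F).eq_or_ssubset with h' | h'
  · rw [h']
  · exact (S.rk_lt F hF _ h.univ_mem h').le

theorem eq_empty_of_rk_eq_zero {F : Finset α} (hF : F ∈ S.flats) (hr : S.rk F = 0) : F = ∅ := by
  by_contra h'
  have := S.rk_lt ∅ h.empty_mem F hF
    (Finset.empty_ssubset.2 (Finset.nonempty_iff_ne_empty.2 h'))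
  omega

theorem exists_covered {G : Finset α} (hG : G ∈ S.flats) (hG0 : G ≠ ∅) :
    ∃ H ∈ S.flats, H ⊂ G ∧ S.rk H + 1 = S.rk G := by
  obtain ⟨H, hH, hmax⟩ := Finset.exists_max_image (S.flats.filter fun H => H ⊂ G) S.rk
    ⟨∅, Finset.mem_filter.2
      ⟨h.empty_mem, Finset.empty_ssubset.2 (Finset.nonempty_iff_ne_empty.2 hG0)⟩⟩
  obtain ⟨h1, h2⟩ := Finset.mem_filter.1 hH
  obtain ⟨a, ha, haH⟩ := Finset.exists_of_ssubset h2
  obtain ⟨K, ⟨k1, k2, k3, k4, k5⟩, -⟩ := S.cover H h1 G hG h2 a ha haH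
  rcases k3.eq_or_ssubset with rfl | hKG
  · exact ⟨H, h1, h2, k5.symm⟩
  · have := hmax K (Finset.mem_filter.2 ⟨k1, hKG⟩)
    omega

theorem pos : ∀ G ∈ S.flats, 0 < b G := by
  have key : ∀ n, ∀ G ∈ S.flats, S.rk G = n → 0 < b G := by
    intro n
    induction n with
    | zero =>
      intro G hG hr
      rw [h.eq_empty_of_rk_eq_zero hG hr, h.map_empty]
      exact one_pos
    | succ n ih =>
      intro G hG hr
      have hG0 : G ≠ ∅ := by
        rintro rfl
        have := h.rk_empty
        omega
      have h1 := h.card_mul G hG hG0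
      obtain ⟨K, k1, k2, k3⟩ := h.exists_covered hG hG0
      have h2 : 0 < (G.card : ℝ) * b G := by
        rw [h1]
        refine Finset.sum_pos (fun H hH => ?_) ⟨K, Finset.mem_filter.2 ⟨k1, k2, k3⟩⟩
        obtain ⟨h3, h4, h5⟩ := Finset.mem_filter.1 hH
        refine mul_pos (sub_pos.2 ?_) (ih H h3 (by omega))
        exact_mod_cast Finset.card_lt_card h4
      exact pos_of_mul_pos_right h2 (Nat.cast_nonneg _)
  exact fun G hG => key _ G hG rfl

theorem weightedWhitney_nonneg (k : ℕ) : 0 ≤ S.weightedWhitney b k :=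
  Finset.sum_nonneg fun H hH =>
    mul_nonneg (Nat.cast_nonneg _) (h.pos H (Finset.mem_filter.1 hH).1).le

theorem whitney_nonneg (k : ℕ) : 0 ≤ S.whitney b k :=
  Finset.sum_nonneg fun H hH => (h.pos H (Finset.mem_filter.1 hH).1).le

theorem exists_rk_eq {k : ℕ} (hk : k ≤ S.rk Finset.univ) : ∃ H ∈ S.flats, S.rk H = k := by
  induction k with
  | zero => exact ⟨∅, h.empty_mem, h.rk_empty⟩
  | succ k ih =>
    obtain ⟨H, h1, h2⟩ := ih (by omega)
    have h3 : H ⊂ Finset.univ := by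
      rw [Finset.ssubset_univ_iff]
      rintro rfl
      omega
    obtain ⟨a, ha, haH⟩ := Finset.exists_of_ssubset h3
    obtain ⟨K, ⟨k1, -, -, -, k5⟩, -⟩ := S.cover H h1 _ h.univ_mem h3 a ha haH
    exact ⟨K, k1, by omega⟩

theorem weightedWhitney_pos {k : ℕ} (hk0 : 0 < k) (hk : k ≤ S.rk Finset.univ) :
    0 < S.weightedWhitney b k := by
  obtain ⟨K, k1, k2⟩ := h.exists_rk_eq hk
  refine Finset.sum_pos (fun H hH => ?_) ⟨K, Finset.mem_filter.2 ⟨k1, k2⟩⟩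
  obtain ⟨h1, h2⟩ := Finset.mem_filter.1 hH
  have h3 : H ≠ ∅ := by
    rintro rfl
    have := h.rk_empty
    omega
  exact mul_pos (Nat.cast_pos.2 (Finset.card_pos.2 (Finset.nonempty_iff_ne_empty.2 h3)))
    (h.pos H h1)

theorem weightedWhitney_zero : S.weightedWhitney b 0 = 0 := by
  refine Finset.sum_eq_zero fun H hH => ?_
  obtain ⟨h1, h2⟩ := Finset.mem_filter.1 hH
  rw [h.eq_empty_of_rk_eq_zero h1 h2]
  simp

theorem weightedWhitney_eq_zero {k : ℕ} (hk : S.rk Finset.univ < k) :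
    S.weightedWhitney b k = 0 := by
  refine Finset.sum_eq_zero fun H hH => ?_
  obtain ⟨h1, h2⟩ := Finset.mem_filter.1 hH
  have := h.rk_le h1
  omega

theorem weightedWhitney_succ (k : ℕ) : S.weightedWhitney b (k + 1) =
    ∑ H ∈ S.flats with S.rk H = k, ((Fintype.card α : ℝ) - H.card) * b H := by
  calc S.weightedWhitney b (k + 1)
      = ∑ G ∈ S.flats with S.rk G = k + 1, ∑ H ∈ S.flats with S.rk H = k,
          if H ⊂ G then ((G.card : ℝ) - H.card) * b H else 0 := by
        refine Finset.sum_congr rfl fun G hG => ?_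
        obtain ⟨h1, h2⟩ := Finset.mem_filter.1 hG
        have hG0 : G ≠ ∅ := by
          rintro rfl
          have := h.rk_empty
          omega
        rw [h.card_mul G h1 hG0, ← Finset.sum_filter, Finset.filter_filter]
        refine Finset.sum_congr (Finset.filter_congr fun H _ => ?_) fun _ _ => rfl
        rw [h2, add_left_inj, and_comm]
    _ = ∑ H ∈ S.flats with S.rk H = k, ∑ G ∈ S.covers H Finset.univ,
          ((G.card : ℝ) - H.card) * b H := by
        rw [Finset.sum_comm]
        refine Finset.sum_congr rfl fun H hH => ?_
        rw [← Finset.sum_filter, Finset.filter_filter]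
        refine Finset.sum_congr (Finset.filter_congr fun G _ => ?_) fun _ _ => rfl
        rw [(Finset.mem_filter.1 hH).2]
        simp [and_comm]
    _ = _ := by
        refine Finset.sum_congr rfl fun H hH => ?_
        obtain ⟨h1, h2⟩ := Finset.mem_filter.1 hH
        rw [← Finset.sum_mul]
        congr 1
        rcases (Finset.subset_univ H).eq_or_ssubset with rfl | h'
        · rw [Finset.card_univ, sub_self]
          refine Finset.sum_eq_zero fun G hG => ?_
          exact absurd (Finset.subset_univ G) (mem_covers.1 hG).2.1.2
        · rw [S.sum_covers h1 h.univ_mem h', Finset.card_univ]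

theorem card_mul_whitney (k : ℕ) : (Fintype.card α : ℝ) * S.whitney b k =
    S.weightedWhitney b k + S.weightedWhitney b (k + 1) := by
  rw [h.weightedWhitney_succ, weightedWhitney, ← Finset.sum_add_distrib, whitney, Finset.mul_sum]
  exact Finset.sum_congr rfl fun H _ => by ring

theorem weightedWhitney_logConcave (k : ℕ) :
    S.weightedWhitney b k * S.weightedWhitney b (k + 2) ≤ S.weightedWhitney b (k + 1) ^ 2 := by
  rcases Nat.eq_zero_or_pos k with rfl | hk0
  · rw [h.weightedWhitney_zero, zero_mul]
    exact sq_nonneg _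
  rcases lt_or_ge (S.rk Finset.univ) (k + 2) with hk | hk
  · rw [h.weightedWhitney_eq_zero hk, mul_zero]
    exact sq_nonneg _
  set T := S.truncate (k + 2) h.univ_mem hk with hT
  have hrk : ∀ H, T.rk H = min (S.rk H) (k + 2) := fun H => rfl
  have hmem : ∀ H, H ∈ T.flats ↔ H = Finset.univ ∨ (H ∈ S.flats ∧ S.rk H < k + 2) := by
    intro H
    rw [hT, truncate, Finset.mem_insert, Finset.mem_filter]
  have hrE : T.rk Finset.univ = k + 2 := by rw [hrk]; omega
  have hfil : ∀ i, 0 < i → i ≤ k + 2 →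
      T.flats.filter (fun H => H ⊂ Finset.univ ∧ T.rk H + i = T.rk Finset.univ) =
        S.flats.filter fun H => S.rk H = k + 2 - i := by
    intro i hi hik
    ext H
    rw [Finset.mem_filter, Finset.mem_filter, hmem, hrE, hrk, Finset.ssubset_univ_iff]
    constructor
    · rintro ⟨h1 | ⟨h1, h1'⟩, h2, h3⟩
      · exact absurd h1 h2
      · exact ⟨h1, by omega⟩
    · rintro ⟨h1, h2⟩
      refine ⟨Or.inr ⟨h1, by omega⟩, ?_, by omega⟩
      rintro rfl
      omega
  have key := T.sum_mul_sum_le_sq_of_recursion ((hmem ∅).2 (Or.inr ⟨h.empty_mem, by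
    rw [h.rk_empty]; omega⟩)) (by rw [hrk, h.rk_empty]; omega) ((hmem _).2 (Or.inl rfl))
    (by omega) b h.map_empty (by
      intro G hG hG0 hGE
      obtain ⟨h1, h2⟩ : G ∈ S.flats ∧ S.rk G < k + 2 :=
        ((hmem G).1 hG).resolve_left hGE.ne
      rw [h.card_mul G h1 hG0.ne']
      refine Finset.sum_congr ?_ fun _ _ => rfl
      ext H
      rw [Finset.mem_filter, Finset.mem_filter, hmem, hrk, hrk]
      constructor
      · rintro ⟨h3, h4, h5⟩
        exact ⟨Or.inr ⟨h3, by omega⟩, h4, by omega⟩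
      · rintro ⟨h3, h4, h5⟩
        obtain ⟨h6, h7⟩ : H ∈ S.flats ∧ S.rk H < k + 2 :=
          h3.resolve_left (h4.trans hGE).ne
        exact ⟨h6, h4, by omega⟩)
  rw [hfil 1 one_pos (by omega), hfil 2 two_pos (by omega), Finset.card_univ,
    show k + 2 - 2 = k by omega, show k + 2 - 1 = k + 1 by omega,
    ← h.weightedWhitney_succ] at key
  exact key

/-- The sums of the absolute values of the Möbius function over the flats of each rank form a
log-concave sequence. -/
theorem whitney_logConcave {k : ℕ} (hk : k + 2 ≤ S.rk Finset.univ) :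
    S.whitney b k * S.whitney b (k + 2) ≤ S.whitney b (k + 1) ^ 2 := by
  have h1 := h.weightedWhitney_logConcave k
  have h2 := h.weightedWhitney_logConcave (k + 1)
  have p1 := h.weightedWhitney_pos (k := k + 1) (by omega) (by omega)
  have p2 := h.weightedWhitney_pos (k := k + 2) (by omega) (by omega)
  have p0 := h.weightedWhitney_nonneg k
  have p3 := h.weightedWhitney_nonneg (k + 3)
  have w0 := h.card_mul_whitney k
  have w1 := h.card_mul_whitney (k + 1)
  have w2 := h.card_mul_whitney (k + 2)
  rw [show k + 1 + 2 = k + 3 by ring, show k + 1 + 1 = k + 2 by ring] at h2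
  rw [show k + 1 + 1 = k + 2 by ring] at w1
  rw [show k + 2 + 1 = k + 3 by ring] at w2
  have hN : (0 : ℝ) < Fintype.card α := by
    refine lt_of_le_of_ne (Nat.cast_nonneg _) fun h0 => ?_
    rw [← h0, zero_mul] at w1
    linarith
  set A := S.weightedWhitney b k
  set B := S.weightedWhitney b (k + 1)
  set D := S.weightedWhitney b (k + 2)
  set E := S.weightedWhitney b (k + 3)
  have h3 : A * E ≤ B * D := by
    refine le_of_mul_le_mul_left ?_ (mul_pos p1 p2)
    calc B * D * (A * E) = (A * D) * (B * E) := by ring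
      _ ≤ B ^ 2 * D ^ 2 := mul_le_mul h1 h2 (mul_nonneg p1.le p3) (sq_nonneg _)
      _ = B * D * (B * D) := by ring
  refine le_of_mul_le_mul_left ?_ (pow_pos hN 2)
  calc (Fintype.card α : ℝ) ^ 2 * (S.whitney b k * S.whitney b (k + 2))
      = (Fintype.card α * S.whitney b k) * (Fintype.card α * S.whitney b (k + 2)) := by ring
    _ = (A + B) * (D + E) := by rw [w0, w2]
    _ ≤ (B + D) ^ 2 := by linarith
    _ = (Fintype.card α * S.whitney b (k + 1)) ^ 2 := by rw [w1]
    _ = _ := by ring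

end IsMobius

end FlatSystem

theorem sum_eq_zero_of_add_insert {α R : Type*} [DecidableEq α] [Fintype α] [AddCommMonoid R]
    {f : Finset α → R} (a : α) (h : ∀ T, a ∉ T → f T + f (insert a T) = 0) : ∑ T, f T = 0 := by
  rw [← Finset.powerset_univ, ← Finset.insert_erase (Finset.mem_univ a),
    Finset.sum_powerset_insert (Finset.notMem_erase a _), ← Finset.sum_add_distrib]
  refine Finset.sum_eq_zero fun T hT => h T fun haT => ?_
  exact Finset.notMem_erase a _ (Finset.mem_powerset.1 hT haT)

section MatroidFlats

variable {α : Type*} [Fintype α] (M : Matroid α)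

theorem coe_matroidRank (X : Set α) : (matroidRank M X : ℕ∞) = M.eRk X := by
  obtain ⟨I, hI⟩ := M.exists_isBasis' X
  have key : ∀ J : Set α, ((J.ncard : ℕ) : ℕ∞) = J.encard := fun J =>
    (Set.toFinite J).cast_ncard_eq
  have hg : IsGreatest {m | ∃ I ⊆ X, M.Indep I ∧ I.ncard = m} I.ncard := by
    refine ⟨⟨I, hI.subset, hI.indep, rfl⟩, ?_⟩
    rintro m ⟨J, hJX, hJ, rfl⟩
    have := hJ.encard_le_eRk_of_subset hJX
    rw [← hI.encard_eq_eRk, ← key, ← key] at this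
    exact_mod_cast this
  rw [matroidRank, hg.csSup_eq, key, hI.encard_eq_eRk]

theorem matroidRank_mono {X Y : Set α} (h : X ⊆ Y) : matroidRank M X ≤ matroidRank M Y := by
  have := M.eRk_mono h
  rw [← coe_matroidRank, ← coe_matroidRank] at this
  exact_mod_cast this

theorem matroidRank_closure (X : Set α) : matroidRank M (M.closure X) = matroidRank M X := by
  have := M.eRk_closure_eq X
  rw [← coe_matroidRank, ← coe_matroidRank] at this
  exact_mod_cast this

/-- The closure of a finite set in a matroid on a finite type, as a finset. -/
noncomputable def finsetClosure (S : Finset α) : Finset α :=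
  (Set.toFinite (M.closure (S : Set α))).toFinset

@[simp] theorem coe_finsetClosure (S : Finset α) :
    (finsetClosure M S : Set α) = M.closure (S : Set α) := by
  simp [finsetClosure]

theorem mem_finsetClosure {S : Finset α} {a : α} :
    a ∈ finsetClosure M S ↔ a ∈ M.closure (S : Set α) := by
  simp [finsetClosure]

theorem finsetClosure_idem (S : Finset α) :
    finsetClosure M (finsetClosure M S) = finsetClosure M S := by
  apply Finset.coe_injective
  simp

theorem finsetClosure_mono {S T : Finset α} (h : S ⊆ T) :
    finsetClosure M S ⊆ finsetClosure M T := by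
  rw [← Finset.coe_subset]
  simpa using M.closure_subset_closure (Finset.coe_subset.2 h)

theorem finsetClosure_subset {S F : Finset α} (hF : finsetClosure M F = F) (h : S ⊆ F) :
    finsetClosure M S ⊆ F :=
  hF ▸ finsetClosure_mono M h

theorem matroidRank_finsetClosure (S : Finset α) :
    matroidRank M (finsetClosure M S : Set α) = matroidRank M (S : Set α) := by
  rw [coe_finsetClosure, matroidRank_closure]

theorem finsetClosure_eq_of_subset {S T : Finset α} (h : S ⊆ T)
    (hr : matroidRank M (T : Set α) ≤ matroidRank M (S : Set α)) :
    finsetClosure M S = finsetClosure M T := by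
  apply Finset.coe_injective
  rw [coe_finsetClosure, coe_finsetClosure]
  apply Matroid.IsRkFinite.closure_eq_closure_of_subset_of_eRk_ge_eRk _ (Finset.coe_subset.2 h)
  · rw [← coe_matroidRank, ← coe_matroidRank]
    exact_mod_cast hr
  · rw [← Matroid.eRk_ne_top_iff, ← coe_matroidRank]
    simp

/-- The sets of rank `k`, counted with sign according to the parity of their cardinality. -/
noncomputable def Matroid.signedRankCount (k : ℕ) : ℤ :=
  ∑ T ∈ ({T : Finset α | matroidRank M (T : Set α) = k} : Finset (Finset α)), (-1) ^ T.card

variable {M} (hE : M.E = Set.univ)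
include hE

theorem subset_finsetClosure (S : Finset α) : S ⊆ finsetClosure M S := by
  rw [← Finset.coe_subset, coe_finsetClosure]
  exact M.subset_closure _ (by simp [hE])

variable [DecidableEq α]

theorem matroidRank_insert {S : Finset α} {a : α} (ha : a ∉ finsetClosure M S) :
    matroidRank M (insert a S : Finset α) = matroidRank M (S : Set α) + 1 := by
  rw [mem_finsetClosure] at ha
  have := M.eRk_insert_eq_add_one ⟨hE ▸ Set.mem_univ a, ha⟩
  rw [← coe_matroidRank, ← coe_matroidRank] at this
  rw [Finset.coe_insert]
  exact_mod_cast this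

omit hE in
theorem finsetClosure_insert_of_mem {S : Finset α} {a : α} (ha : a ∈ finsetClosure M S) :
    finsetClosure M (insert a S) = finsetClosure M S := by
  apply Finset.coe_injective
  rw [mem_finsetClosure] at ha
  rw [coe_finsetClosure, coe_finsetClosure, Finset.coe_insert]
  exact Matroid.closure_insert_eq_of_mem_closure ha

/-- The flats of a matroid on a finite type. -/
noncomputable def Matroid.flatSystem : FlatSystem α where
  flats := {F | finsetClosure M F = F}
  rk F := matroidRank M (F : Set α)
  rk_lt F hF G hG hFG := by
    simp only [Finset.mem_filter_univ] at hF hG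
    by_contra! h
    apply hFG.ne
    rw [← hF, ← hG, finsetClosure_eq_of_subset M hFG.subset h]
  cover F hF G hG hFG a ha haF := by
    simp only [Finset.mem_filter_univ] at hF hG ⊢
    have hi := matroidRank_insert hE (hF.symm ▸ haF : a ∉ finsetClosure M F)
    refine ⟨finsetClosure M (insert a F), ⟨finsetClosure_idem M _,
      (Finset.subset_insert a F).trans (subset_finsetClosure hE _),
      finsetClosure_subset M hG (Finset.insert_subset ha hFG.subset),
      subset_finsetClosure hE _ (Finset.mem_insert_self a F), ?_⟩, ?_⟩
    · rw [matroidRank_finsetClosure, hi]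
    · rintro H ⟨hH, hFH, -, haH, hr⟩
      rw [← hH]
      exact (finsetClosure_eq_of_subset M (Finset.insert_subset haH hFH) (by rw [hi, hr])).symm

@[simp] theorem mem_flatSystem_flats {F : Finset α} :
    F ∈ (Matroid.flatSystem hE).flats ↔ finsetClosure M F = F := by
  simp [Matroid.flatSystem]

@[simp] theorem flatSystem_rk (F : Finset α) :
    (Matroid.flatSystem hE).rk F = matroidRank M (F : Set α) := rfl

/-- The Möbius function `μ(∅, F)` of the lattice of flats of a loopless matroid. -/
noncomputable def Matroid.mobius (M : Matroid α) (F : Finset α) : ℝ :=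
  ∑ T : Finset α with finsetClosure M T = F, (-1) ^ T.card

theorem mobius_eq_neg_sum {F : Finset α} (hF : finsetClosure M F = F) {a : α} (ha : a ∈ F) :
    M.mobius F = -∑ G : Finset α with (finsetClosure M G = G ∧ G ⊂ F ∧
      matroidRank M (G : Set α) + 1 = matroidRank M (F : Set α)) ∧ a ∉ G, M.mobius G := by
  have h1 : M.mobius F + ∑ T : Finset α with a ∉ finsetClosure M T ∧
      finsetClosure M (insert a T) = F, (-1 : ℝ) ^ T.card = 0 := by
    rw [Matroid.mobius, Finset.sum_filter, Finset.sum_filter, ← Finset.sum_add_distrib]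
    have key : ∀ T : Finset α, a ∉ T →
        ((if finsetClosure M T = F then (-1 : ℝ) ^ T.card else 0) +
          if a ∉ finsetClosure M T ∧ finsetClosure M (insert a T) = F then (-1) ^ T.card else 0) +
        ((if finsetClosure M (insert a T) = F then (-1 : ℝ) ^ (insert a T).card else 0) +
          if a ∉ finsetClosure M (insert a T) ∧ finsetClosure M (insert a (insert a T)) = F
            then (-1) ^ (insert a T).card else 0) = 0 := by
      intro T haT
      have h2 : a ∈ finsetClosure M (insert a T) :=
        subset_finsetClosure hE _ (Finset.mem_insert_self a T)
      rw [Finset.card_insert_of_notMem haT]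
      by_cases hc : a ∈ finsetClosure M T
      · rw [finsetClosure_insert_of_mem hc]
        by_cases hT : finsetClosure M T = F <;> simp [hT, hc, ha, pow_succ]
      · have hT : finsetClosure M T ≠ F := fun h => hc (h ▸ ha)
        by_cases hT' : finsetClosure M (insert a T) = F <;> simp [hT, hc, hT', ha, h2, pow_succ]
    exact sum_eq_zero_of_add_insert a key
  rw [eq_neg_of_add_eq_zero_left h1]
  congr 1
  have hmaps : ∀ T ∈ ({T : Finset α | a ∉ finsetClosure M T ∧
      finsetClosure M (insert a T) = F} : Finset (Finset α)), finsetClosure M T ∈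
      ({G : Finset α | (finsetClosure M G = G ∧ G ⊂ F ∧
      matroidRank M (G : Set α) + 1 = matroidRank M (F : Set α)) ∧ a ∉ G} :
        Finset (Finset α)) := by
    intro T hT
    simp only [Finset.mem_filter_univ] at hT ⊢
    obtain ⟨h1, h2⟩ := hT
    refine ⟨⟨finsetClosure_idem M T, ⟨?_, fun h => h1 (h ha)⟩, ?_⟩, h1⟩
    · rw [← h2]
      exact finsetClosure_mono M (Finset.subset_insert a T)
    · rw [← h2, matroidRank_finsetClosure, matroidRank_finsetClosure, matroidRank_insert hE h1]
  rw [← Finset.sum_fiberwise_of_maps_to hmaps]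
  refine Finset.sum_congr rfl fun G hG => Finset.sum_congr ?_ fun _ _ => rfl
  simp only [Finset.mem_filter_univ] at hG
  obtain ⟨⟨hG1, hG2, hG3⟩, haG⟩ := hG
  ext T
  simp only [Finset.mem_filter, Finset.mem_univ, true_and, and_iff_right_iff_imp]
  intro hT
  have haT : a ∉ finsetClosure M T := hT ▸ haG
  have hTF : T ⊆ F := ((subset_finsetClosure hE T).trans hT.subset).trans hG2.subset
  refine ⟨haT, ?_⟩
  conv_rhs => rw [← hF]
  refine finsetClosure_eq_of_subset M (Finset.insert_subset ha hTF) ?_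
  rw [matroidRank_insert hE haT, ← matroidRank_finsetClosure M T, hT, hG3]

theorem card_mul_mobius {F : Finset α} (hF : finsetClosure M F = F) :
    (F.card : ℝ) * M.mobius F = -∑ G : Finset α with finsetClosure M G = G ∧ G ⊂ F ∧
      matroidRank M (G : Set α) + 1 = matroidRank M (F : Set α),
        ((F.card : ℝ) - G.card) * M.mobius G := by
  rw [← nsmul_eq_mul, ← Finset.sum_const, Finset.sum_congr rfl fun a ha =>
    mobius_eq_neg_sum hE hF ha, Finset.sum_neg_distrib]
  rw [Finset.sum_comm' (t' := {G : Finset α | finsetClosure M G = G ∧ G ⊂ F ∧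
    matroidRank M (G : Set α) + 1 = matroidRank M (F : Set α)}) (s' := fun G => {a ∈ F | a ∉ G})
    (fun a G => by simp only [Finset.mem_filter, Finset.mem_univ, true_and]; tauto)]
  congr 1
  refine Finset.sum_congr rfl fun G hG => ?_
  simp only [Finset.mem_filter_univ] at hG
  rw [Finset.sum_const, nsmul_eq_mul, Finset.filter_notMem_eq_sdiff,
    Finset.card_sdiff_of_subset hG.2.1.subset, Nat.cast_sub (Finset.card_le_card hG.2.1.subset)]

theorem isMobius_flatSystem (hl : finsetClosure M ∅ = ∅) :
    (Matroid.flatSystem hE).IsMobius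
      fun F => (-1) ^ matroidRank M (F : Set α) * M.mobius F where
  empty_mem := by simpa using hl
  univ_mem := by
    simpa using Finset.univ_subset_iff.1 (subset_finsetClosure hE Finset.univ)
  rk_empty := by
    have := coe_matroidRank M ∅
    rw [Matroid.eRk_empty] at this
    simpa using this
  map_empty := by
    have h0 : matroidRank M ∅ = 0 := by
      have := coe_matroidRank M ∅
      rw [Matroid.eRk_empty] at this
      exact_mod_cast this
    have h1 : ({T : Finset α | finsetClosure M T = ∅} : Finset (Finset α)) = {∅} := by
      ext T
      simp only [Finset.mem_filter_univ, Finset.mem_singleton]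
      exact ⟨fun h => Finset.subset_empty.1 (h ▸ subset_finsetClosure hE T), fun h => h ▸ hl⟩
    simp [Matroid.mobius, h0, h1]
  card_mul G hG _ := by
    replace hG : finsetClosure M G = G := by simpa using hG
    rw [mul_left_comm, card_mul_mobius hE hG, mul_neg, ← neg_mul, Finset.mul_sum]
    refine Finset.sum_congr (by ext; rw [Finset.mem_filter, Finset.mem_filter]; simp) fun H hH => ?_
    rw [Finset.mem_filter, mem_flatSystem_flats] at hH
    simp only [flatSystem_rk] at hH
    rw [← hH.2.2, pow_succ]
    ring

theorem whitney_flatSystem (k : ℕ) :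
    (Matroid.flatSystem hE).whitney (fun F => (-1) ^ matroidRank M (F : Set α) * M.mobius F) k =
      (-1) ^ k * (M.signedRankCount k : ℝ) := by
  have hmaps : ∀ T ∈ ({T : Finset α | matroidRank M (T : Set α) = k} : Finset (Finset α)),
      finsetClosure M T ∈ ({G : Finset α | finsetClosure M G = G ∧
        matroidRank M (G : Set α) = k} : Finset (Finset α)) := by
    intro T hT
    simp only [Finset.mem_filter_univ] at hT ⊢
    exact ⟨finsetClosure_idem M T, by rw [matroidRank_finsetClosure, hT]⟩
  rw [Matroid.signedRankCount, Int.cast_sum, ← Finset.sum_fiberwise_of_maps_to hmaps,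
    Finset.mul_sum]
  refine Finset.sum_congr (by ext; rw [Finset.mem_filter]; simp) fun G hG => ?_
  replace hG := (Finset.mem_filter.1 hG).2
  beta_reduce
  rw [hG.2, Matroid.mobius]
  congr 1
  refine Finset.sum_congr ?_ fun _ _ => by simp
  ext T
  rw [Finset.mem_filter_univ, Finset.mem_filter, Finset.mem_filter_univ]
  exact ⟨fun h => ⟨by rw [← matroidRank_finsetClosure, h, hG.2], h⟩, fun h => h.2⟩

omit hE in
theorem signedRankCount_eq_zero {a : α} (ha : a ∈ finsetClosure M ∅) (k : ℕ) :
    M.signedRankCount k = 0 := by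
  have key : ∀ T : Finset α, matroidRank M (insert a T : Finset α) = matroidRank M (T : Set α) := by
    intro T
    rw [← matroidRank_finsetClosure, finsetClosure_insert_of_mem
      (finsetClosure_mono M (Finset.empty_subset T) ha), matroidRank_finsetClosure]
  rw [Matroid.signedRankCount, Finset.sum_filter]
  refine sum_eq_zero_of_add_insert a fun T haT => ?_
  rw [key, Finset.card_insert_of_notMem haT]
  split_ifs <;> simp [pow_succ]

end MatroidFlats

theorem coeff_matroidCharPoly {α : Type*} [Fintype α] (M : Matroid α) (r : ℕ)
    (hrank : matroidRank M Set.univ = r + 1) {k : ℕ} (hk : k ≤ r + 1) :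
    (matroidCharPoly M r).coeff (r + 1 - k) =
      M.signedRankCount k := by
  rw [matroidCharPoly, Matroid.signedRankCount, Polynomial.finsetSum_coeff, Finset.sum_filter]
  refine Finset.sum_congr rfl fun T _ => ?_
  have h1 : matroidRank M (T : Set α) ≤ r + 1 := hrank ▸ matroidRank_mono M (Set.subset_univ _)
  have h2 : ((-1 : Polynomial ℤ) ^ T.card) = Polynomial.C ((-1) ^ T.card) := by simp
  rw [h2, Polynomial.coeff_C_mul, Polynomial.coeff_X_pow]
  by_cases h : matroidRank M (T : Set α) = k
  · simp [h]
  · rw [if_neg h, if_neg (by omega), mul_zero]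

/-- **Log-concavity of the f-vector of the broken circuit complex.**
If `M` is a matroid of rank `r + 1` on a finite ground set and `f` is the f-vector of its
broken circuit complex, defined by `χ_M(q) = Σ_{k=0}^{r+1} (−1)^k f_k q^{r+1−k}`, then
`f_k ≥ 0` for all `0 ≤ k ≤ r+1` and `f_{k-1} f_{k+1} ≤ f_k ^ 2` for all `0 < k < r+1`. -/
theorem fvector_brokenCircuit_logConcave {α : Type*} [Fintype α] (M : Matroid α)
    (hE : M.E = Set.univ) (r : ℕ) (hrank : matroidRank M Set.univ = r + 1)
    (f : ℕ → ℤ)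
    (hf : matroidCharPoly M r =
      ∑ k ∈ Finset.range (r + 2), C ((-1) ^ k * f k) * X ^ (r + 1 - k)) :
    (∀ k ≤ r + 1, 0 ≤ f k) ∧
    (∀ k : ℕ, 0 < k → k < r + 1 → f (k - 1) * f (k + 1) ≤ f k ^ 2) := by
  classical
  have hfk : ∀ k ≤ r + 1, f k =
      (-1) ^ k * M.signedRankCount k := by
    intro k hk
    rw [← coeff_matroidCharPoly M r hrank hk, hf, Polynomial.finsetSum_coeff,
      Finset.sum_eq_single_of_mem k (Finset.mem_range.2 (by omega))]
    · rw [Polynomial.coeff_C_mul, Polynomial.coeff_X_pow, if_pos rfl, mul_one, ← mul_assoc,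
        ← mul_pow, neg_one_mul, neg_neg, one_pow, one_mul]
    · intro j hj hjk
      rw [Finset.mem_range] at hj
      rw [Polynomial.coeff_C_mul, Polynomial.coeff_X_pow, if_neg (by omega), mul_zero]
  by_cases hl : finsetClosure M ∅ = ∅
  · have hM := isMobius_flatSystem hE hl
    have hcast : ∀ k ≤ r + 1, (f k : ℝ) = (Matroid.flatSystem hE).whitney
        (fun F => (-1) ^ matroidRank M (F : Set α) * M.mobius F) k := by
      intro k hk
      rw [hfk k hk, whitney_flatSystem hE]
      push_cast
      rfl
    refine ⟨fun k hk => ?_, fun k h0 hk => ?_⟩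
    · have := hM.whitney_nonneg k
      rw [← hcast k hk] at this
      exact_mod_cast this
    · obtain ⟨j, rfl⟩ : ∃ j, k = j + 1 := ⟨k - 1, by omega⟩
      have hr : (Matroid.flatSystem hE).rk Finset.univ = r + 1 := by
        simpa using hrank
      have := hM.whitney_logConcave (k := j) (by omega)
      rw [← hcast j (by omega), ← hcast (j + 1) (by omega), ← hcast (j + 2) (by omega)] at this
      rw [Nat.add_sub_cancel]
      exact_mod_cast this
  · obtain ⟨a, ha⟩ := Finset.nonempty_iff_ne_empty.2 hl
    have hf0 : ∀ k ≤ r + 1, f k = 0 := fun k hk => by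
      rw [hfk k hk, signedRankCount_eq_zero ha, mul_zero]
    refine ⟨fun k hk => (hf0 k hk).ge, fun k h0 hk => ?_⟩
    rw [hf0 (k + 1) (by omega), hf0 k (by omega)]
    simp
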